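/- arXiv:1411.7249 — 4 statements merged into one kernel-verified Lean document; each statement's English description precedes it below -/
import Mathlib

section
/- Let (f_d)_{d≥1} be a (β₁,β₂,C_d,D,α,υ,δ)-family of functions with C_d = O(d^υ). Then, uniformly for all integers d ≥ 1 and all reals P ≥ 2: ∑_{k,l ≥ 1, k^{β₁}·l^{β₂} ≤ P} f_d(k,l) = C_d·P·log P + O(d^{υ+δ}·(1 + log d)·P). -/
open scoped BigOperators

noncomputable section

/-- The truncated double sum `∑_{1 ≤ k ≤ K} ∑_{1 ≤ l ≤ L} f_d(k,l)`. -/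
def boxSum (f : ℕ → ℕ → ℕ → ℝ) (d : ℕ) (K L : ℝ) : ℝ :=
  ∑ k ∈ Finset.Icc 1 ⌊K⌋₊, ∑ l ∈ Finset.Icc 1 ⌊L⌋₊, f d k l

/-- Condition (I) of a `(β₁,β₂,C_d,D,α,υ,δ)`-family:
`∑_{k≤K} ∑_{l≤L} f_d(k,l) = C_d K^{β₁} L^{β₂} + O(d^υ K^{β₁} L^{β₂} min(K,L)^{-δ})`
uniformly for all `d ≥ 1` and `K, L ≥ 1`. -/
def FamilyCondI (β₁ β₂ υ δ : ℝ) (f : ℕ → ℕ → ℕ → ℝ) (C : ℕ → ℝ) : Prop :=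
  ∃ C₁ : ℝ, ∀ d : ℕ, 1 ≤ d → ∀ K L : ℝ, 1 ≤ K → 1 ≤ L →
    |boxSum f d K L - C d * K ^ β₁ * L ^ β₂| ≤
      C₁ * (d : ℝ) ^ υ * K ^ β₁ * L ^ β₂ * (min K L) ^ (-δ)

/-- First half of condition (II): `∑_{l≤L} f_d(k,l) = c_{d,1}(k) L^{β₂} + O(k^D d^υ L^{β₂-δ})`
uniformly for all `L ≥ 1` and `1 ≤ k ≤ d⁻¹ L^α`. -/
def FamilyCondII₁ (β₂ α δ D υ : ℝ) (f : ℕ → ℕ → ℕ → ℝ) (c₁ : ℕ → ℕ → ℝ) : Prop :=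
  ∃ C₂ : ℝ, ∀ d : ℕ, 1 ≤ d → ∀ k : ℕ, 1 ≤ k → ∀ L : ℝ, 1 ≤ L →
    (k : ℝ) ≤ (d : ℝ)⁻¹ * L ^ α →
    |(∑ l ∈ Finset.Icc 1 ⌊L⌋₊, f d k l) - c₁ d k * L ^ β₂| ≤
      C₂ * (k : ℝ) ^ D * (d : ℝ) ^ υ * L ^ (β₂ - δ)

/-- Second half of condition (II): `∑_{k≤K} f_d(k,l) = c_{d,2}(l) K^{β₁} + O(l^D d^υ K^{β₁-δ})`
uniformly for all `K ≥ 1` and `1 ≤ l ≤ d⁻¹ K^α`. -/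
def FamilyCondII₂ (β₁ α δ D υ : ℝ) (f : ℕ → ℕ → ℕ → ℝ) (c₂ : ℕ → ℕ → ℝ) : Prop :=
  ∃ C₂ : ℝ, ∀ d : ℕ, 1 ≤ d → ∀ l : ℕ, 1 ≤ l → ∀ K : ℝ, 1 ≤ K →
    (l : ℝ) ≤ (d : ℝ)⁻¹ * K ^ α →
    |(∑ k ∈ Finset.Icc 1 ⌊K⌋₊, f d k l) - c₂ d l * K ^ β₁| ≤
      C₂ * (l : ℝ) ^ D * (d : ℝ) ^ υ * K ^ (β₁ - δ)


section HyperbolaMethod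

open Finset

/-- The sum of `f` over the rectangle `1 ≤ k ≤ K`, `1 ≤ l ≤ L`. -/
def rectSum (f : ℕ → ℕ → ℝ) (K L : ℝ) : ℝ :=
  ∑ k ∈ Icc 1 ⌊K⌋₊, ∑ l ∈ Icc 1 ⌊L⌋₊, f k l

/-- The sum of `f` over the lattice points `k, l ≥ 1` with `k ≤ K` and `k ^ a * l ^ b ≤ P`. -/
def hyperbolicSum (f : ℕ → ℕ → ℝ) (a b P K : ℝ) : ℝ :=
  ∑ k ∈ Icc 1 ⌊K⌋₊, ∑ l ∈ Icc 1 ⌊(P / (k : ℝ) ^ a) ^ b⁻¹⌋₊, f k l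

lemma sum_Icc_one_floor_sub (g : ℕ → ℝ) {K K' : ℝ} (h : K ≤ K') :
    ∑ k ∈ Icc 1 ⌊K'⌋₊, g k - ∑ k ∈ Icc 1 ⌊K⌋₊, g k = ∑ k ∈ Ioc ⌊K⌋₊ ⌊K'⌋₊, g k := by
  have e : ∀ n : ℕ, Icc 1 n = Ioc 0 n := fun n ↦ by ext; simp [Nat.succ_le_iff]
  rw [e, e, ← Finset.sum_Ioc_consecutive g (Nat.zero_le _) (Nat.floor_le_floor h)]
  ring

lemma hyperbolicSum_sub_le {f : ℕ → ℕ → ℝ} (hf : ∀ k l, 0 ≤ f k l) {a b P K K' : ℝ}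
    (ha : 0 ≤ a) (hb : 0 ≤ b) (hP : 0 ≤ P) (hK : 0 < K) (h : K ≤ K') :
    hyperbolicSum f a b P K' - hyperbolicSum f a b P K ≤
      rectSum f K' ((P / K ^ a) ^ b⁻¹) - rectSum f K ((P / K ^ a) ^ b⁻¹) := by
  unfold hyperbolicSum rectSum
  rw [sum_Icc_one_floor_sub _ h, sum_Icc_one_floor_sub _ h]
  refine sum_le_sum fun k hk ↦ sum_le_sum_of_subset_of_nonneg ?_ fun _ _ _ ↦ hf _ _
  have hKk : K ≤ k := ((Nat.floor_lt hK.le).1 (mem_Ioc.1 hk).1).le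
  refine Icc_subset_Icc le_rfl (Nat.floor_le_floor ?_)
  gcongr

lemma le_hyperbolicSum_sub {f : ℕ → ℕ → ℝ} (hf : ∀ k l, 0 ≤ f k l) {a b P K K' : ℝ}
    (ha : 0 ≤ a) (hb : 0 ≤ b) (hP : 0 ≤ P) (hK : 0 < K) (h : K ≤ K') :
    rectSum f K' ((P / K' ^ a) ^ b⁻¹) - rectSum f K ((P / K' ^ a) ^ b⁻¹) ≤
      hyperbolicSum f a b P K' - hyperbolicSum f a b P K := by
  unfold hyperbolicSum rectSum
  rw [sum_Icc_one_floor_sub _ h, sum_Icc_one_floor_sub _ h]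
  refine sum_le_sum fun k hk ↦ sum_le_sum_of_subset_of_nonneg ?_ fun _ _ _ ↦ hf _ _
  have hKk : K < k := (Nat.floor_lt hK.le).1 (mem_Ioc.1 hk).1
  have hk0 : (0 : ℝ) < k := hK.trans hKk
  have hkK : (k : ℝ) ≤ K' := (Nat.le_floor_iff (hK.le.trans h)).1 (mem_Ioc.1 hk).2
  have hPK : 0 ≤ P / K' ^ a := div_nonneg hP (Real.rpow_nonneg (hK.le.trans h) a)
  refine Icc_subset_Icc le_rfl (Nat.floor_le_floor ?_)
  gcongr

/-- The rectangle sums of `f` are `C * K ^ a * L ^ b` up to a relative error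
`B * (min K L) ^ (-δ)`. -/
def RectSumAsymptotic (f : ℕ → ℕ → ℝ) (a b δ C B : ℝ) : Prop :=
  ∀ K L : ℝ, 1 ≤ K → 1 ≤ L →
    |rectSum f K L - C * K ^ a * L ^ b| ≤ B * K ^ a * L ^ b * (min K L) ^ (-δ)

lemma RectSumAsymptotic.abs_sub_le_of_le_min {f : ℕ → ℕ → ℝ} {a b δ C B : ℝ}
    (h : RectSumAsymptotic f a b δ C B) (hδ : 0 ≤ δ) (hB : 0 ≤ B) {A K L : ℝ} (hA : 1 ≤ A)
    (hK : A ≤ K) (hL : A ≤ L) :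
    |rectSum f K L - C * K ^ a * L ^ b| ≤ B * K ^ a * L ^ b * A ^ (-δ) := by
  have hK0 : 0 < K := by linarith
  have hL0 : 0 < L := by linarith
  refine (h K L (hA.trans hK) (hA.trans hL)).trans ?_
  refine mul_le_mul_of_nonneg_left ?_ (by positivity)
  exact Real.rpow_le_rpow_of_nonpos (by linarith) (le_min hK hL) (by linarith)

lemma abs_hyperbolicSum_sub_slice_le {f : ℕ → ℕ → ℝ} (hf : ∀ k l, 0 ≤ f k l)
    {a b δ C B : ℝ} (ha : 0 < a) (hb : 0 < b) (hδ : 0 ≤ δ) (hC : 0 ≤ C) (hB : 0 ≤ B)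
    (h : RectSumAsymptotic f a b δ C B) {A K K' P t : ℝ} (hA : 1 ≤ A) (hP : 0 ≤ P) (hK : A ≤ K)
    (ht0 : 0 ≤ t) (ht1 : t ≤ 1) (hKK' : K' ^ a = K ^ a * Real.exp t) (hK'0 : 0 ≤ K')
    (hAP : A ^ b ≤ P / K' ^ a) :
    |hyperbolicSum f a b P K' - hyperbolicSum f a b P K - C * P * t| ≤
      P * (C * t ^ 2 + 4 * B * A ^ (-δ)) := by
  have hK0 : 0 < K := by linarith
  have hA0 : 0 < A := by linarith
  have hle : K ≤ K' := by
    rw [← Real.rpow_le_rpow_iff hK0.le hK'0 ha, hKK']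
    exact le_mul_of_one_le_right (by positivity) (Real.one_le_exp ht0)
  have hK' : 0 < K' := by linarith
  have hexp := abs_le.1 (Real.abs_exp_sub_one_sub_id_le (x := t) (by rwa [abs_of_nonneg ht0]))
  have hexp' := abs_le.1 (Real.abs_exp_sub_one_sub_id_le (x := -t)
    (by rwa [abs_neg, abs_of_nonneg ht0]))
  have key : ∀ L M : ℝ, L = (P / M ^ a) ^ b⁻¹ → 0 < M → M ≤ K' →
      L ^ b = P / M ^ a ∧ A ≤ L := by
    intro L M hL hM hMK
    have h1 : L ^ b = P / M ^ a := by
      rw [hL, Real.rpow_inv_rpow (by positivity) hb.ne']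
    refine ⟨h1, ?_⟩
    rw [← Real.rpow_le_rpow_iff hA0.le (by rw [hL]; positivity) hb, h1]
    refine hAP.trans ?_
    gcongr
  have hup := hyperbolicSum_sub_le hf ha.le hb.le hP hK0 hle
  have hlo := le_hyperbolicSum_sub hf ha.le hb.le hP hK0 hle
  obtain ⟨e1, l1⟩ := key _ K rfl hK0 hle
  obtain ⟨e2, l2⟩ := key _ K' rfl hK' le_rfl
  have a1 := abs_le.1 (h.abs_sub_le_of_le_min hδ hB hA (hK.trans hle) l1)
  have a2 := abs_le.1 (h.abs_sub_le_of_le_min hδ hB hA hK l1)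
  have a3 := abs_le.1 (h.abs_sub_le_of_le_min hδ hB hA (hK.trans hle) l2)
  have a4 := abs_le.1 (h.abs_sub_le_of_le_min hδ hB hA hK l2)
  have hKa : 0 < K ^ a := by positivity
  have r1 : ∀ x : ℝ, x * K' ^ a * (P / K ^ a) = x * P * Real.exp t := by
    intro x; rw [hKK']; field_simp
  have r2 : ∀ x : ℝ, x * K ^ a * (P / K ^ a) = x * P := by
    intro x; field_simp
  have r3 : ∀ x : ℝ, x * K' ^ a * (P / K' ^ a) = x * P := by
    intro x; field_simp
  have r4 : ∀ x : ℝ, x * K ^ a * (P / K' ^ a) = x * P * Real.exp (-t) := by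
    intro x; rw [hKK', Real.exp_neg]; field_simp
  rw [e1, r1, r1] at a1
  rw [e1, r2, r2] at a2
  rw [e2, r3, r3] at a3
  rw [e2, r4, r4] at a4
  have ht2 : t ^ 2 ≤ 1 := by nlinarith
  have hCP : 0 ≤ C * P := by positivity
  have hBP : 0 ≤ B * P * A ^ (-δ) := by positivity
  have m1 : C * P * (Real.exp t - 1 - t) ≤ C * P * t ^ 2 :=
    mul_le_mul_of_nonneg_left hexp.2 hCP
  have m2 : C * P * (Real.exp (-t) - 1 - -t) ≤ C * P * t ^ 2 :=
    mul_le_mul_of_nonneg_left (by simpa using hexp'.2) hCP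
  have m3 : B * P * A ^ (-δ) * Real.exp t ≤ B * P * A ^ (-δ) * 3 :=
    mul_le_mul_of_nonneg_left (by linarith [hexp.2]) hBP
  have m4 : B * P * A ^ (-δ) * Real.exp (-t) ≤ B * P * A ^ (-δ) * 3 :=
    mul_le_mul_of_nonneg_left (by have := Real.exp_le_one_iff.2 (neg_nonpos.2 ht0); linarith) hBP
  rw [abs_le]
  constructor <;> linarith [a1.1, a1.2, a2.1, a2.2, a3.1, a3.2, a4.1, a4.2]

lemma abs_hyperbolicSum_sub_le {f : ℕ → ℕ → ℝ} (hf : ∀ k l, 0 ≤ f k l)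
    {a b δ C B : ℝ} (ha : 0 < a) (hb : 0 < b) (hδ : 0 ≤ δ) (hC : 0 ≤ C) (hB : 0 ≤ B)
    (h : RectSumAsymptotic f a b δ C B) {A P T : ℝ} (hA : 1 ≤ A)
    (hT0 : 0 ≤ T) (hT : P = A ^ a * A ^ b * Real.exp T) {N : ℕ} (hN : 0 < N) (hTN : T ≤ N) :
    |hyperbolicSum f a b P ((P / A ^ b) ^ a⁻¹) - hyperbolicSum f a b P A - C * P * T| ≤
      P * (C * (T ^ 2 / N) + 4 * N * B * A ^ (-δ)) := by
  have hA0 : 0 < A := by linarith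
  have hN0 : (0 : ℝ) < N := by exact_mod_cast hN
  have hP : 0 < P := by rw [hT]; positivity
  let K : ℕ → ℝ := fun i ↦ (A ^ a * Real.exp (i * (T / N))) ^ a⁻¹
  have hKpos : ∀ i, 0 < K i := fun i ↦ by positivity
  have hKa : ∀ i, K i ^ a = A ^ a * Real.exp (i * (T / N)) := fun i ↦
    Real.rpow_inv_rpow (by positivity) ha.ne'
  have hAK : ∀ i, A ≤ K i := fun i ↦ by
    rw [← Real.rpow_le_rpow_iff hA0.le (hKpos i).le ha, hKa]
    exact le_mul_of_one_le_right (by positivity) (Real.one_le_exp (by positivity))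
  have h0 : K 0 = A := by
    simp only [K, Nat.cast_zero, zero_mul, Real.exp_zero, mul_one]
    exact Real.rpow_rpow_inv hA0.le ha.ne'
  have hlast : K N = (P / A ^ b) ^ a⁻¹ := by
    simp only [K]
    congr 1
    rw [hT, mul_div_cancel₀ T hN0.ne']
    field_simp
  have step : ∀ i ∈ range N,
      |hyperbolicSum f a b P (K (i + 1)) - hyperbolicSum f a b P (K i) - C * P * (T / N)| ≤
        P * (C * (T / N) ^ 2 + 4 * B * A ^ (-δ)) := by
    intro i hi
    refine abs_hyperbolicSum_sub_slice_le hf ha hb hδ hC hB h hA hP.le (hAK i) (by positivity)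
      (by rwa [div_le_one hN0]) ?_ (hKpos _).le ?_
    · rw [hKa, hKa, mul_assoc, ← Real.exp_add]
      push_cast
      ring_nf
    · rw [hKa, le_div_iff₀ (by positivity), hT]
      have : (((i + 1 : ℕ) : ℝ)) * (T / N) ≤ T := by
        have h1 : ((i + 1 : ℕ) : ℝ) ≤ N := by exact_mod_cast Finset.mem_range.1 hi
        calc ((i + 1 : ℕ) : ℝ) * (T / N) ≤ N * (T / N) := by gcongr
          _ = T := by field_simp
      have := Real.exp_le_exp.2 this
      calc _ = A ^ a * A ^ b * Real.exp (((i + 1 : ℕ) : ℝ) * (T / N)) := by ring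
        _ ≤ _ := by gcongr
  have tele : hyperbolicSum f a b P ((P / A ^ b) ^ a⁻¹) - hyperbolicSum f a b P A - C * P * T =
      ∑ i ∈ range N, (hyperbolicSum f a b P (K (i + 1)) - hyperbolicSum f a b P (K i)
        - C * P * (T / N)) := by
    rw [sum_sub_distrib, sum_range_sub (fun i ↦ hyperbolicSum f a b P (K i)), h0, hlast]
    simp only [sum_const, card_range, nsmul_eq_mul]
    field_simp
  rw [tele]
  refine (abs_sum_le_sum_abs _ _).trans ((sum_le_sum step).trans (le_of_eq ?_))
  simp only [sum_const, card_range, nsmul_eq_mul]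
  field_simp

/-- For `k` small in terms of `L`, the partial sums up to `L` of the row `f k` are
`c k * L ^ b`, with an error that depends polynomially on `k`. -/
def RowSumAsymptotic (f : ℕ → ℕ → ℝ) (b α δ D B y : ℝ) (c : ℕ → ℝ) : Prop :=
  ∀ k : ℕ, 1 ≤ k → ∀ L : ℝ, 1 ≤ L → y * k ≤ L ^ α →
    |∑ l ∈ Icc 1 ⌊L⌋₊, f k l - c k * L ^ b| ≤ B * (k : ℝ) ^ D * L ^ (b - δ)

open Filter Topology in
lemma RowSumAsymptotic.abs_sum_coeff_sub_le {f : ℕ → ℕ → ℝ} {a b α δ D B C y : ℝ} {c : ℕ → ℝ}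
    (hrow : RowSumAsymptotic f b α δ D B y c) (h : RectSumAsymptotic f a b δ C B)
    (hα : 0 < α) (hδ : 0 < δ) (hy : 0 ≤ y) {K : ℝ} (hK : 1 ≤ K) :
    |∑ k ∈ Icc 1 ⌊K⌋₊, c k - C * K ^ a| ≤ B * K ^ (a - δ) := by
  have hK0 : 0 < K := by linarith
  set S : ℝ := ∑ k ∈ Icc 1 ⌊K⌋₊, (k : ℝ) ^ D with hS
  have hlim : Tendsto (fun L : ℝ ↦ B * S * L ^ (-δ) + B * K ^ (a - δ)) atTop
      (𝓝 (B * S * 0 + B * K ^ (a - δ))) :=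
    ((tendsto_rpow_neg_atTop hδ).const_mul _).add_const _
  rw [mul_zero, zero_add] at hlim
  refine ge_of_tendsto hlim ?_
  filter_upwards [eventually_ge_atTop K, (tendsto_rpow_atTop hα).eventually_ge_atTop (y * K)]
    with L hKL hL
  have hL1 : 1 ≤ L := hK.trans hKL
  have hL0 : 0 < L := by linarith
  have hLb : 0 < L ^ b := by positivity
  have h1 := h K L hK hL1
  rw [min_eq_left hKL] at h1
  have h2 : |∑ k ∈ Icc 1 ⌊K⌋₊, (∑ l ∈ Icc 1 ⌊L⌋₊, f k l - c k * L ^ b)| ≤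
      B * S * L ^ (b - δ) := by
    refine (abs_sum_le_sum_abs _ _).trans ?_
    rw [hS, mul_sum, sum_mul]
    refine sum_le_sum fun k hk ↦ hrow k (mem_Icc.1 hk).1 L hL1 (le_trans ?_ hL)
    have : (k : ℝ) ≤ K := (Nat.le_floor_iff hK0.le).1 (mem_Icc.1 hk).2
    gcongr
  rw [sum_sub_distrib, ← sum_mul] at h2
  change |rectSum f K L - _| ≤ _ at h2
  have h3 : |(∑ k ∈ Icc 1 ⌊K⌋₊, c k - C * K ^ a) * L ^ b| ≤
      (B * S * L ^ (-δ) + B * K ^ (a - δ)) * L ^ b := by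
    have e1 : L ^ (b - δ) = L ^ (-δ) * L ^ b := by rw [← Real.rpow_add hL0]; ring_nf
    have e2 : K ^ (a - δ) = K ^ a * K ^ (-δ) := by rw [← Real.rpow_add hK0]; ring_nf
    rw [e1] at h2
    rw [e2]
    rw [abs_le] at *
    constructor <;> linarith [h1.1, h1.2, h2.1, h2.2]
  rw [abs_mul, abs_of_pos hLb] at h3
  exact le_of_mul_le_mul_right h3 hLb

lemma abs_sum_mul_rpow_neg_sub_le {c : ℕ → ℝ} {a δ B C : ℝ} (ha : 0 < a) (hδ : 0 < δ)
    (hC : 0 ≤ C) (hB : 0 ≤ B)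
    (h : ∀ t : ℝ, 1 ≤ t → |∑ k ∈ Icc 1 ⌊t⌋₊, c k - C * t ^ a| ≤ B * t ^ (a - δ))
    {A : ℝ} (hA : 1 ≤ A) :
    |∑ k ∈ Icc 1 ⌊A⌋₊, c k / (k : ℝ) ^ a - C * a * Real.log A| ≤ C + B * (1 + a / δ) := by
  have hA0 : 0 < A := by linarith
  set c' : ℕ → ℝ := fun k ↦ if k = 0 then 0 else c k with hc'
  have sumIcc : ∀ (g : ℕ → ℝ) (n : ℕ), ∑ k ∈ Icc 0 n, g k * c' k = ∑ k ∈ Icc 1 n, g k * c k := by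
    intro g n
    rw [← sum_subset (Icc_subset_Icc (Nat.zero_le 1) le_rfl)]
    · refine sum_congr rfl fun k hk ↦ ?_
      rw [hc']
      simp only
      rw [if_neg (by have := (mem_Icc.1 hk).1; omega)]
    · intro k hk hk'
      have : k = 0 := by simp only [mem_Icc] at hk hk'; omega
      simp [hc', this]
  have hM : ∀ t : ℝ, 1 ≤ t → |∑ k ∈ Icc 0 ⌊t⌋₊, c' k - C * t ^ a| ≤ B * t ^ (a - δ) := by
    intro t ht
    have := sumIcc (fun _ ↦ 1) ⌊t⌋₊
    simp only [one_mul] at this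
    rw [this]
    exact h t ht
  have hderiv : ∀ t ∈ Set.Icc 1 A, deriv (fun t : ℝ ↦ t ^ (-a)) t = -a * t ^ (-a - 1) := by
    intro t _
    exact Real.deriv_rpow_const t (-a)
  have hne : ∀ t ∈ Set.uIcc 1 A, t ≠ 0 := by
    intro t ht
    rw [Set.uIcc_of_le hA] at ht
    linarith [ht.1]
  have hcont : ∀ r : ℝ, ContinuousOn (fun t : ℝ ↦ t ^ r) (Set.Icc 1 A) := fun r t ht ↦
    (Real.continuousAt_rpow_const t r (Or.inl (by linarith [ht.1]))).continuousWithinAt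
  have hderiv_int : MeasureTheory.IntegrableOn (deriv fun t : ℝ ↦ t ^ (-a)) (Set.Icc 1 A) := by
    refine MeasureTheory.IntegrableOn.congr_fun ?_ (fun t ht ↦ (hderiv t ht).symm)
      measurableSet_Icc
    exact ((hcont _).const_mul _).integrableOn_Icc
  have habel := sum_mul_eq_sub_integral_mul₀ (f := fun t : ℝ ↦ t ^ (-a)) c' (by simp [hc']) A
    (fun t ht ↦ (Real.differentiableAt_rpow_const_of_ne (-a) (by linarith [ht.1]))) hderiv_int
  rw [sumIcc (fun k ↦ (k : ℝ) ^ (-a))] at habel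
  have hlhs : ∑ k ∈ Icc 1 ⌊A⌋₊, c k / (k : ℝ) ^ a = ∑ k ∈ Icc 1 ⌊A⌋₊, (k : ℝ) ^ (-a) * c k := by
    refine sum_congr rfl fun k _ ↦ ?_
    rw [Real.rpow_neg (Nat.cast_nonneg k), div_eq_inv_mul]
  have hintegrand := integrableOn_mul_sum_Icc (m := 0) c' zero_le_one hderiv_int
  rw [← intervalIntegral.integral_of_le hA] at habel
  have hii : IntervalIntegrable (fun t ↦ deriv (fun t : ℝ ↦ t ^ (-a)) t * ∑ k ∈ Icc 0 ⌊t⌋₊, c' k)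
      MeasureTheory.volume 1 A :=
    (intervalIntegrable_iff_integrableOn_Icc_of_le hA).2 hintegrand
  have hinv : IntervalIntegrable (fun t : ℝ ↦ C * a * t⁻¹) MeasureTheory.volume 1 A :=
    (intervalIntegral.intervalIntegrable_inv (fun t ht ↦ hne t ht) continuousOn_id).const_mul _
  have hlog : ∫ t in (1 : ℝ)..A, C * a * t⁻¹ = C * a * Real.log A := by
    rw [intervalIntegral.integral_const_mul, integral_inv_of_pos one_pos hA0, div_one]
  have hbound : ‖∫ t in (1 : ℝ)..A, (deriv (fun t : ℝ ↦ t ^ (-a)) t * ∑ k ∈ Icc 0 ⌊t⌋₊, c' k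
      + C * a * t⁻¹)‖ ≤ ∫ t in (1 : ℝ)..A, a * B * t ^ (-1 - δ) := by
    refine intervalIntegral.norm_integral_le_of_norm_le hA ?_ ?_
    · refine Filter.Eventually.of_forall fun t ht ↦ ?_
      have ht1 : 1 ≤ t := ht.1.le
      have ht0 : 0 < t := by linarith
      rw [hderiv t ⟨ht1, ht.2⟩, Real.norm_eq_abs]
      have e1 : t⁻¹ = t ^ (-a - 1) * t ^ a := by
        rw [← Real.rpow_add ht0, ← Real.rpow_neg_one]; ring_nf
      have e2 : t ^ (-1 - δ) = t ^ (-a - 1) * t ^ (a - δ) := by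
        rw [← Real.rpow_add ht0]; ring_nf
      have e3 : -a * t ^ (-a - 1) * ∑ k ∈ Icc 0 ⌊t⌋₊, c' k + C * a * t⁻¹ =
          -(a * t ^ (-a - 1) * (∑ k ∈ Icc 0 ⌊t⌋₊, c' k - C * t ^ a)) := by rw [e1]; ring
      rw [e3, e2, abs_neg, abs_mul, abs_of_nonneg (a := a * t ^ (-a - 1)) (by positivity)]
      calc _ ≤ a * t ^ (-a - 1) * (B * t ^ (a - δ)) := by gcongr; exact hM t ht1
        _ = _ := by ring
    · refine (ContinuousOn.intervalIntegrable ?_)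
      rw [Set.uIcc_of_le hA]
      exact (hcont _).const_mul _
  have hval : ∫ t in (1 : ℝ)..A, a * B * t ^ (-1 - δ) ≤ B * (a / δ) := by
    rw [intervalIntegral.integral_const_mul, integral_rpow
      (Or.inr ⟨by linarith, fun h0 ↦ hne 0 h0 rfl⟩)]
    have e : (A ^ (-1 - δ + 1) - 1 ^ (-1 - δ + 1)) / (-1 - δ + 1) = (1 - A ^ (-δ)) / δ := by
      rw [show -1 - δ + 1 = -δ by ring, Real.one_rpow, div_neg, ← neg_div]; ring_nf
    rw [e]
    have : (1 - A ^ (-δ)) / δ ≤ 1 / δ := by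
      gcongr
      linarith [Real.rpow_nonneg hA0.le (-δ)]
    calc _ ≤ a * B * (1 / δ) := by gcongr
      _ = _ := by ring
  rw [intervalIntegral.integral_add hii hinv, hlog, Real.norm_eq_abs] at hbound
  have hend : |A ^ (-a) * ∑ k ∈ Icc 0 ⌊A⌋₊, c' k| ≤ C + B := by
    have h1 := abs_le.1 (hM A hA)
    have h2 : |∑ k ∈ Icc 0 ⌊A⌋₊, c' k| ≤ (C + B) * A ^ a := by
      have : A ^ (a - δ) ≤ A ^ a := Real.rpow_le_rpow_of_exponent_le hA (by linarith)
      have h3 := mul_le_mul_of_nonneg_left this hB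
      have h4 : 0 ≤ C * A ^ a := by positivity
      rw [abs_le]
      constructor <;> linarith [h1.1, h1.2]
    rw [abs_mul, abs_of_nonneg (Real.rpow_nonneg hA0.le _)]
    calc _ ≤ A ^ (-a) * ((C + B) * A ^ a) := by gcongr
      _ = (C + B) * (A ^ (-a) * A ^ a) := by ring
      _ = C + B := by rw [← Real.rpow_add hA0]; simp
  rw [hlhs, habel]
  have h1 := abs_le.1 (hbound.trans hval)
  have h2 := abs_le.1 hend
  rw [abs_le]
  constructor <;> linarith [h1.1, h1.2, h2.1, h2.2]

/-- The sum over the strip `k ≤ A` below the hyperbola, for `A` at most a small power of `P`. -/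
lemma RowSumAsymptotic.abs_hyperbolicSum_sub_le {f : ℕ → ℕ → ℝ} {a b α δ D B C y : ℝ}
    {c : ℕ → ℝ} (hrow : RowSumAsymptotic f b α δ D B y c) (h : RectSumAsymptotic f a b δ C B)
    (ha : 0 < a) (hb : 0 < b) (hα : 0 < α) (hδ : 0 < δ) (hD : 0 ≤ D) (hB : 0 ≤ B) (hC : 0 ≤ C)
    (hy : 1 ≤ y) {μ A P : ℝ} (hμ0 : 0 ≤ μ) (hμ1 : μ * b ≤ (1 - μ * a) * α)
    (hμ2 : μ * (1 + D) * b ≤ (1 - μ * a) * δ) (hA : 1 ≤ A) (hP : 1 ≤ P) (hAP : y * A ≤ P ^ μ) :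
    |hyperbolicSum f a b P A - C * P * (a * Real.log A)| ≤ P * (C + B * (2 + a / δ)) := by
  have hA0 : 0 < A := by linarith
  have hP0 : 0 < P := by linarith
  have hμa : 0 ≤ 1 - μ * a := by
    by_contra! hneg
    have : 0 ≤ μ * b := by positivity
    nlinarith
  have hAμ : A ≤ P ^ μ := le_trans (le_mul_of_one_le_left hA0.le hy) hAP
  have hrowk : ∀ k ∈ Icc 1 ⌊A⌋₊,
      |∑ l ∈ Icc 1 ⌊(P / (k : ℝ) ^ a) ^ b⁻¹⌋₊, f k l - P * (c k / (k : ℝ) ^ a)| ≤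
        B * P * P ^ (-μ) := by
    intro k hk
    have hk1 : 1 ≤ k := (mem_Icc.1 hk).1
    have hk1' : (1 : ℝ) ≤ k := by exact_mod_cast hk1
    have hk0 : (0 : ℝ) < k := by linarith
    have hkA : (k : ℝ) ≤ A := (Nat.le_floor_iff hA0.le).1 (mem_Icc.1 hk).2
    have hka : (k : ℝ) ^ a ≤ P ^ (μ * a) := by
      rw [Real.rpow_mul hP0.le]
      exact Real.rpow_le_rpow hk0.le (hkA.trans hAμ) ha.le
    set L := (P / (k : ℝ) ^ a) ^ b⁻¹ with hL
    have hL0 : 0 < L := by positivity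
    have hLb : L ^ b = P / (k : ℝ) ^ a := Real.rpow_inv_rpow (by positivity) hb.ne'
    have hLge : P ^ ((1 - μ * a) / b) ≤ L := by
      rw [hL, div_eq_mul_inv (1 - μ * a), Real.rpow_mul hP0.le]
      refine Real.rpow_le_rpow (by positivity) ?_ (by positivity)
      rw [Real.rpow_sub hP0, Real.rpow_one]
      gcongr
    have hL1 : 1 ≤ L := (Real.one_le_rpow hP (by positivity)).trans hLge
    have hLα : y * k ≤ L ^ α := by
      calc y * k ≤ y * A := by gcongr
        _ ≤ P ^ μ := hAP
        _ ≤ P ^ ((1 - μ * a) / b * α) := by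
          refine Real.rpow_le_rpow_of_exponent_le hP ?_
          rw [div_mul_eq_mul_div, le_div_iff₀ hb]
          exact hμ1
        _ ≤ L ^ α := by
          rw [Real.rpow_mul hP0.le]
          exact Real.rpow_le_rpow (by positivity) hLge hα.le
    have h1 := hrow k hk1 L hL1 hLα
    rw [hLb] at h1
    rw [mul_div_assoc', mul_comm P, ← mul_div_assoc']
    refine h1.trans ?_
    have hkD : (k : ℝ) ^ D ≤ P ^ (μ * D) := by
      rw [Real.rpow_mul hP0.le]
      exact Real.rpow_le_rpow hk0.le (hkA.trans hAμ) hD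
    have hLP : L ^ (b - δ) ≤ P * P ^ (-((1 - μ * a) / b * δ)) := by
      rw [sub_eq_add_neg, Real.rpow_add hL0, hLb]
      refine mul_le_mul (div_le_self hP0.le (Real.one_le_rpow hk1' ha.le)) ?_ (by positivity)
        hP0.le
      rw [← mul_neg, Real.rpow_mul hP0.le]
      exact Real.rpow_le_rpow_of_nonpos (by positivity) hLge (by linarith)
    calc B * (k : ℝ) ^ D * L ^ (b - δ) ≤
        B * P ^ (μ * D) * (P * P ^ (-((1 - μ * a) / b * δ))) := by gcongr
      _ = B * P * P ^ (μ * D + -((1 - μ * a) / b * δ)) := by rw [Real.rpow_add hP0]; ring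
      _ ≤ B * P * P ^ (-μ) := by
        refine mul_le_mul_of_nonneg_left (Real.rpow_le_rpow_of_exponent_le hP ?_) (by positivity)
        have : μ * (1 + D) ≤ (1 - μ * a) / b * δ := by
          rw [div_mul_eq_mul_div, le_div_iff₀ hb]
          exact hμ2
        linarith
  have hsum : |hyperbolicSum f a b P A - P * ∑ k ∈ Icc 1 ⌊A⌋₊, c k / (k : ℝ) ^ a| ≤ B * P := by
    unfold hyperbolicSum
    rw [mul_sum, ← sum_sub_distrib]
    refine (abs_sum_le_sum_abs _ _).trans ((sum_le_sum hrowk).trans ?_)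
    simp only [sum_const, Nat.card_Icc, add_tsub_cancel_right, nsmul_eq_mul]
    calc (⌊A⌋₊ : ℝ) * (B * P * P ^ (-μ)) ≤ P ^ μ * (B * P * P ^ (-μ)) := by
          gcongr
          exact (Nat.floor_le hA0.le).trans hAμ
      _ = B * P * (P ^ μ * P ^ (-μ)) := by ring
      _ = B * P := by rw [← Real.rpow_add hP0]; simp
  have hmain := abs_sum_mul_rpow_neg_sub_le ha hδ hC hB
    (fun t ht ↦ hrow.abs_sum_coeff_sub_le h hα hδ (by linarith) ht) hA
  have h1 := abs_le.1 hsum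
  have h2 : |P * (∑ k ∈ Icc 1 ⌊A⌋₊, c k / (k : ℝ) ^ a - C * a * Real.log A)| ≤
      P * (C + B * (1 + a / δ)) := by
    rw [abs_mul, abs_of_pos hP0]
    gcongr
  have h3 := abs_le.1 h2
  rw [abs_le]
  constructor <;> linarith [h1.1, h1.2, h3.1, h3.2]

lemma rectSum_swap (f : ℕ → ℕ → ℝ) (K L : ℝ) :
    rectSum (fun l k ↦ f k l) L K = rectSum f K L :=
  sum_comm

lemma sum_Icc_one_floor_eq_sum_ite (g : ℕ → ℝ) {x : ℝ} (hx : 0 ≤ x) {N : ℕ} (hN : ⌊x⌋₊ ≤ N) :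
    ∑ k ∈ Icc 1 ⌊x⌋₊, g k = ∑ k ∈ Icc 1 N, if (k : ℝ) ≤ x then g k else 0 := by
  rw [← sum_filter]
  refine sum_congr ?_ fun _ _ ↦ rfl
  ext k
  simp only [mem_Icc, mem_filter, Nat.le_floor_iff hx]
  constructor
  · rintro ⟨h1, h2⟩
    exact ⟨⟨h1, (Nat.le_floor h2).trans hN⟩, h2⟩
  · rintro ⟨⟨h1, _⟩, h2⟩
    exact ⟨h1, h2⟩

lemma le_div_rpow_rpow_inv_iff {a b P k l : ℝ} (hb : 0 < b) (hP : 0 ≤ P) (hk : 0 < k)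
    (hl : 0 ≤ l) : l ≤ (P / k ^ a) ^ b⁻¹ ↔ k ^ a * l ^ b ≤ P := by
  rw [Real.le_rpow_inv_iff_of_pos hl (by positivity) hb, le_div_iff₀' (by positivity)]

lemma rectSum_eq_sum_ite (f : ℕ → ℕ → ℝ) {K L : ℝ} (hK : 0 ≤ K) (hL : 0 ≤ L) {N : ℕ}
    (hKN : ⌊K⌋₊ ≤ N) (hLN : ⌊L⌋₊ ≤ N) :
    rectSum f K L = ∑ k ∈ Icc 1 N, ∑ l ∈ Icc 1 N,
      if (k : ℝ) ≤ K ∧ (l : ℝ) ≤ L then f k l else 0 := by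
  unfold rectSum
  rw [sum_Icc_one_floor_eq_sum_ite _ hK hKN]
  refine sum_congr rfl fun k _ ↦ ?_
  rw [sum_Icc_one_floor_eq_sum_ite _ hL hLN]
  split_ifs with h <;> simp [h]

lemma hyperbolicSum_eq_sum_ite (f : ℕ → ℕ → ℝ) {a b P K : ℝ} (ha : 0 ≤ a) (hb : 0 < b)
    (hP : 0 ≤ P) (hK : 0 ≤ K) {N : ℕ} (hKN : ⌊K⌋₊ ≤ N) (hPN : ⌊P ^ b⁻¹⌋₊ ≤ N) :
    hyperbolicSum f a b P K = ∑ k ∈ Icc 1 N, ∑ l ∈ Icc 1 N,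
      if (k : ℝ) ≤ K ∧ (k : ℝ) ^ a * (l : ℝ) ^ b ≤ P then f k l else 0 := by
  unfold hyperbolicSum
  rw [sum_Icc_one_floor_eq_sum_ite _ hK hKN]
  refine sum_congr rfl fun k hk ↦ ?_
  have hk1 : (1 : ℝ) ≤ k := by exact_mod_cast (mem_Icc.1 hk).1
  have hk0 : (0 : ℝ) < k := by linarith
  have hle : ⌊(P / (k : ℝ) ^ a) ^ b⁻¹⌋₊ ≤ N := by
    refine (Nat.floor_le_floor ?_).trans hPN
    refine Real.rpow_le_rpow (by positivity) ?_ (by positivity)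
    exact div_le_self hP (Real.one_le_rpow hk1 ha)
  rw [sum_Icc_one_floor_eq_sum_ite _ (by positivity) hle]
  simp only [le_div_rpow_rpow_inv_iff hb hP hk0 (Nat.cast_nonneg _)]
  split_ifs with h <;> simp [h]

lemma le_rpow_inv_of_rpow_mul_le {a b P k l : ℝ} (ha : 0 < a) (hb : 0 ≤ b) (hP : 0 ≤ P)
    (hk : 0 ≤ k) (hl : 1 ≤ l) (h : k ^ a * l ^ b ≤ P) : k ≤ P ^ a⁻¹ := by
  rw [Real.le_rpow_inv_iff_of_pos hk hP ha]
  exact (le_mul_of_one_le_right (by positivity) (Real.one_le_rpow hl hb)).trans h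

lemma ite_and_eq_add_sub {p q r s : Prop} [Decidable p] [Decidable q] [Decidable r] [Decidable s]
    (hps : p → s) (hqr : q → r → p) (hpr : p → ¬r → q) (x : ℝ) :
    (if s ∧ p then x else 0) =
      (if q ∧ p then x else 0) + (if r ∧ p then x else 0) - if q ∧ r then x else 0 := by
  by_cases p <;> by_cases q <;> by_cases r <;> simp_all

/-- Dirichlet's hyperbola decomposition: a point below the hyperbola has `k ≤ (P / A ^ b) ^ a⁻¹`
or `l ≤ A`, and the points with both properties form a rectangle. -/
lemma hyperbolicSum_eq_add_sub_rectSum (f : ℕ → ℕ → ℝ) {a b P A : ℝ} (ha : 0 < a) (hb : 0 < b)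
    (hP : 0 ≤ P) (hA : 0 < A) :
    hyperbolicSum f a b P (P ^ a⁻¹) = hyperbolicSum f a b P ((P / A ^ b) ^ a⁻¹) +
      hyperbolicSum (fun l k ↦ f k l) b a P A - rectSum f ((P / A ^ b) ^ a⁻¹) A := by
  set K := (P / A ^ b) ^ a⁻¹ with hK
  have hK0 : 0 ≤ K := by positivity
  set N := ⌊P ^ a⁻¹⌋₊ + ⌊P ^ b⁻¹⌋₊ + ⌊K⌋₊ + ⌊A⌋₊ with hN
  rw [hyperbolicSum_eq_sum_ite f (N := N) ha.le hb hP (by positivity) (by omega) (by omega),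
    hyperbolicSum_eq_sum_ite f (N := N) ha.le hb hP hK0 (by omega) (by omega),
    hyperbolicSum_eq_sum_ite _ (N := N) hb.le ha hP hA.le (by omega) (by omega),
    rectSum_eq_sum_ite f (N := N) hK0 hA.le (by omega) (by omega)]
  rw [sum_comm (s := Icc 1 N) (t := Icc 1 N) (f := fun k l : ℕ ↦
    if (k : ℝ) ≤ A ∧ (k : ℝ) ^ b * (l : ℝ) ^ a ≤ P then f l k else 0)]
  simp only [← sum_add_distrib, ← sum_sub_distrib]
  refine sum_congr rfl fun k hk ↦ sum_congr rfl fun l hl ↦ ?_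
  have hk1 : (1 : ℝ) ≤ k := by exact_mod_cast (mem_Icc.1 hk).1
  have hl1 : (1 : ℝ) ≤ l := by exact_mod_cast (mem_Icc.1 hl).1
  have hk0 : (0 : ℝ) < k := by linarith
  have i1 : (k : ℝ) ^ a * (l : ℝ) ^ b ≤ P → (k : ℝ) ≤ P ^ a⁻¹ :=
    le_rpow_inv_of_rpow_mul_le ha hb.le hP hk0.le hl1
  have i2 : (k : ℝ) ≤ K ↔ A ^ b * (k : ℝ) ^ a ≤ P := le_div_rpow_rpow_inv_iff ha hP hA hk0.le
  have i3 : (l : ℝ) ^ b * (k : ℝ) ^ a = (k : ℝ) ^ a * (l : ℝ) ^ b := mul_comm _ _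
  have i4 : (k : ℝ) ≤ K → (l : ℝ) ≤ A → (k : ℝ) ^ a * (l : ℝ) ^ b ≤ P := by
    intro h1 h2
    rw [i2] at h1
    refine le_trans ?_ h1
    rw [mul_comm]
    gcongr
  have i5 : (k : ℝ) ^ a * (l : ℝ) ^ b ≤ P → ¬ (l : ℝ) ≤ A → (k : ℝ) ≤ K := by
    intro h1 h2
    rw [i2]
    refine le_trans ?_ h1
    rw [mul_comm]
    push Not at h2
    gcongr
  rw [i3]
  exact ite_and_eq_add_sub i1 i4 i5 _

lemma tsum_ite_eq_hyperbolicSum (f : ℕ → ℕ → ℝ) {a b P : ℝ} (ha : 0 < a) (hb : 0 < b)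
    (hP : 0 ≤ P) :
    (∑' kl : ℕ × ℕ, if 1 ≤ kl.1 ∧ 1 ≤ kl.2 ∧ (kl.1 : ℝ) ^ a * (kl.2 : ℝ) ^ b ≤ P then
      f kl.1 kl.2 else 0) = hyperbolicSum f a b P (P ^ a⁻¹) := by
  set N := ⌊P ^ a⁻¹⌋₊ + ⌊P ^ b⁻¹⌋₊ with hN
  have hbound : ∀ k l : ℕ, 1 ≤ k → 1 ≤ l → (k : ℝ) ^ a * (l : ℝ) ^ b ≤ P →
      (k : ℝ) ≤ P ^ a⁻¹ ∧ (l : ℝ) ≤ P ^ b⁻¹ := by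
    intro k l hk hl h
    have hk1 : (1 : ℝ) ≤ k := by exact_mod_cast hk
    have hl1 : (1 : ℝ) ≤ l := by exact_mod_cast hl
    exact ⟨le_rpow_inv_of_rpow_mul_le ha hb.le hP (by linarith) hl1 h,
      le_rpow_inv_of_rpow_mul_le hb ha.le hP (by linarith) hk1 (by rwa [mul_comm])⟩
  rw [tsum_eq_sum (s := Icc 1 N ×ˢ Icc 1 N), sum_product,
    hyperbolicSum_eq_sum_ite f (N := N) ha.le hb hP (by positivity) (by omega) (by omega)]
  · refine sum_congr rfl fun k hk ↦ sum_congr rfl fun l hl ↦ ?_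
    have hk1 := (mem_Icc.1 hk).1
    have hl1 := (mem_Icc.1 hl).1
    refine if_congr ⟨fun h ↦ ⟨(hbound k l h.1 h.2.1 h.2.2).1, h.2.2⟩, fun h ↦ ⟨hk1, hl1, h.2⟩⟩
      rfl rfl
  · rintro ⟨k, l⟩ hkl
    refine if_neg fun h ↦ hkl ?_
    obtain ⟨h1, h2⟩ := hbound k l h.1 h.2.1 h.2.2
    have h1' := Nat.le_floor h1
    have h2' := Nat.le_floor h2
    simp only [mem_product, mem_Icc]
    exact ⟨⟨h.1, by omega⟩, h.2.1, by omega⟩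

lemma RectSumAsymptotic.abs_rectSum_le {f : ℕ → ℕ → ℝ} {a b δ C B : ℝ}
    (h : RectSumAsymptotic f a b δ C B) (hδ : 0 ≤ δ) (hC : 0 ≤ C) (hB : 0 ≤ B) {K L : ℝ}
    (hK : 1 ≤ K) (hL : 1 ≤ L) : |rectSum f K L| ≤ (C + B) * (K ^ a * L ^ b) := by
  have h1 := abs_le.1 (h.abs_sub_le_of_le_min hδ hB le_rfl hK hL)
  have hK0 : 0 < K := by linarith
  have hL0 : 0 < L := by linarith
  have h2 : 0 ≤ C * K ^ a * L ^ b := by positivity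
  rw [Real.one_rpow, mul_one] at h1
  rw [abs_le]
  constructor <;> linarith [h1.1, h1.2]

lemma one_add_log_sq_mul_rpow_neg_le {P ε : ℝ} (hP : 1 ≤ P) (hε : 0 < ε) :
    (1 + Real.log P) ^ 2 * P ^ (-ε) ≤ (1 + 2 / ε) ^ 2 := by
  have hP0 : 0 < P := by linarith
  have h1 : 1 + Real.log P ≤ (1 + 2 / ε) * P ^ (ε / 2) := by
    have h2 := Real.log_le_rpow_div hP0.le (half_pos hε)
    have h3 := Real.one_le_rpow hP (half_pos hε).le
    have h4 : P ^ (ε / 2) / (ε / 2) = 2 / ε * P ^ (ε / 2) := by field_simp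
    rw [h4] at h2
    linarith
  have h0 : 0 ≤ 1 + Real.log P := by linarith [Real.log_nonneg hP]
  calc (1 + Real.log P) ^ 2 * P ^ (-ε) ≤ ((1 + 2 / ε) * P ^ (ε / 2)) ^ 2 * P ^ (-ε) := by gcongr
    _ = (1 + 2 / ε) ^ 2 * (P ^ (ε / 2) * P ^ (ε / 2) * P ^ (-ε)) := by ring
    _ = (1 + 2 / ε) ^ 2 := by
      rw [← Real.rpow_add hP0, ← Real.rpow_add hP0, add_halves, add_neg_cancel, Real.rpow_zero,
        mul_one]

/-- The asymptotic formula when `P` is large in terms of `y`. -/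
lemma abs_hyperbolicSum_sub_le_of_le_rpow {f : ℕ → ℕ → ℝ} (hf : ∀ k l, 0 ≤ f k l)
    {a b α δ D B C y μ P : ℝ} {c₁ c₂ : ℕ → ℝ}
    (ha : 0 < a) (hb : 0 < b) (hα : 0 < α) (hδ : 0 < δ) (hD : 0 ≤ D) (hC : 0 ≤ C) (hCB : C ≤ B)
    (h : RectSumAsymptotic f a b δ C B) (h₁ : RowSumAsymptotic f b α δ D B y c₁)
    (h₂ : RowSumAsymptotic (fun l k ↦ f k l) a α δ D B y c₂)
    (hμ : 0 < μ) (hμab : μ * (a + b) ≤ 1)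
    (hμ₁ : μ * b ≤ (1 - μ * a) * α) (hμ₁' : μ * (1 + D) * b ≤ (1 - μ * a) * δ)
    (hμ₂ : μ * a ≤ (1 - μ * b) * α) (hμ₂' : μ * (1 + D) * a ≤ (1 - μ * b) * δ)
    (hP : 1 ≤ P) (hy : 1 ≤ y) (hyP : y ≤ P ^ μ) :
    |hyperbolicSum f a b P (P ^ a⁻¹) - C * P * Real.log P| ≤
      (9 + (a + b) / δ + 8 * (1 + 2 / (μ * δ)) ^ 2) * B * y ^ δ * P := by
  have hB : 0 ≤ B := hC.trans hCB
  have hP0 : 0 < P := by linarith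
  have hy0 : 0 < y := by linarith
  have hlogP : 0 ≤ Real.log P := Real.log_nonneg hP
  have hyδ : 1 ≤ y ^ δ := Real.one_le_rpow hy hδ.le
  set A := P ^ μ / y with hAdef
  have hA : 1 ≤ A := (one_le_div hy0).2 hyP
  have hA0 : 0 < A := by linarith
  have hyA : y * A ≤ P ^ μ := by rw [hAdef, mul_div_cancel₀ _ hy0.ne']
  have hlogA : 0 ≤ Real.log A := Real.log_nonneg hA
  have hlogAP : Real.log A ≤ μ * Real.log P := by
    rw [← Real.log_rpow hP0]
    exact Real.log_le_log hA0 (div_le_self (by positivity) hy)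
  set T := Real.log P - (a + b) * Real.log A with hTdef
  have hT0 : 0 ≤ T := by
    have : (a + b) * Real.log A ≤ (a + b) * (μ * Real.log P) := by gcongr
    have : μ * (a + b) * Real.log P ≤ 1 * Real.log P := by gcongr
    linarith
  have hTP : T ≤ Real.log P := by
    have : 0 ≤ (a + b) * Real.log A := by positivity
    linarith
  have hPT : P = A ^ a * A ^ b * Real.exp T := by
    rw [← Real.rpow_add hA0, Real.rpow_def_of_pos hA0, ← Real.exp_add, hTdef]
    rw [show Real.log A * (a + b) + (Real.log P - (a + b) * Real.log A) = Real.log P by ring,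
      Real.exp_log hP0]
  set N := ⌈(1 + T) ^ 2⌉₊ with hNdef
  have hN1 : (1 + T) ^ 2 ≤ N := Nat.le_ceil _
  have hN2 : (N : ℝ) ≤ 2 * (1 + Real.log P) ^ 2 := by
    have h3 := (Nat.ceil_lt_add_one (a := (1 + T) ^ 2) (by positivity)).le
    have h4 : (1 + T) ^ 2 ≤ (1 + Real.log P) ^ 2 := by gcongr
    nlinarith
  have hN0 : 0 < N := Nat.ceil_pos.2 (by positivity)
  have hN0' : (0 : ℝ) < N := by exact_mod_cast hN0
  have hmid := abs_hyperbolicSum_sub_le hf ha hb hδ.le hC hB h hA hT0 hPT hN0 (by nlinarith)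
  have hs₁ := h₁.abs_hyperbolicSum_sub_le h ha hb hα hδ hD hB hC hy hμ.le hμ₁ hμ₁' hA hP hyA
  have hswap : RectSumAsymptotic (fun l k ↦ f k l) b a δ C B := by
    intro L K hL hK
    rw [rectSum_swap, min_comm]
    convert h K L hK hL using 1
    · ring_nf
    · ring
  have hs₂ := h₂.abs_hyperbolicSum_sub_le hswap hb ha hα hδ hD hB hC hy hμ.le hμ₂ hμ₂' hA hP hyA
  have hKmax : 1 ≤ (P / A ^ b) ^ a⁻¹ := by
    refine Real.one_le_rpow ?_ (by positivity)
    rw [hPT, one_le_div (by positivity)]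
    have h3 := Real.one_le_rpow hA ha.le
    have h4 := Real.one_le_exp hT0
    calc A ^ b = 1 * A ^ b * 1 := by ring
      _ ≤ _ := by gcongr
  have hrect := h.abs_rectSum_le hδ.le hC hB hKmax hA
  rw [Real.rpow_inv_rpow (by positivity) ha.ne', div_mul_cancel₀ P (by positivity)] at hrect
  have hmid' : P * (C * (T ^ 2 / N) + 4 * N * B * A ^ (-δ)) ≤
      P * (B * 1 + 8 * B * y ^ δ * (1 + 2 / (μ * δ)) ^ 2) := by
    have h3 : T ^ 2 / N ≤ 1 := by
      rw [div_le_one hN0']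
      nlinarith
    have h4 : A ^ (-δ) = P ^ (-(μ * δ)) * y ^ δ := by
      rw [hAdef, Real.div_rpow (by positivity) hy0.le, ← Real.rpow_mul hP0.le,
        Real.rpow_neg hy0.le, div_inv_eq_mul, mul_neg]
    have h5 := one_add_log_sq_mul_rpow_neg_le hP (mul_pos hμ hδ)
    have h6 : 4 * N * B * A ^ (-δ) ≤ 8 * B * y ^ δ * (1 + 2 / (μ * δ)) ^ 2 := by
      rw [h4]
      calc 4 * N * B * (P ^ (-(μ * δ)) * y ^ δ) ≤
            4 * (2 * (1 + Real.log P) ^ 2) * B * (P ^ (-(μ * δ)) * y ^ δ) := by gcongr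
        _ = 8 * B * y ^ δ * ((1 + Real.log P) ^ 2 * P ^ (-(μ * δ))) := by ring
        _ ≤ _ := by gcongr
    gcongr
  have hfin : P * (9 + (a + b) / δ) * B ≤ P * (9 + (a + b) / δ) * B * y ^ δ :=
    le_mul_of_one_le_right (by positivity) hyδ
  have hPC : P * C ≤ P * B := by gcongr
  rw [hyperbolicSum_eq_add_sub_rectSum f ha hb hP0.le hA0]
  have hlog : C * P * Real.log P = C * P * (a * Real.log A) + C * P * (b * Real.log A) +
      C * P * T := by rw [hTdef]; ring
  rw [hlog]
  have hdiv : (a + b) / δ = a / δ + b / δ := add_div _ _ _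
  rw [hdiv] at hfin ⊢
  rw [abs_le] at *
  constructor <;> linarith [hmid.1, hmid.2, hs₁.1, hs₁.2, hs₂.1, hs₂.2, hrect.1, hrect.2]

lemma abs_hyperbolicSum_sub_le_log {f : ℕ → ℕ → ℝ} (hf : ∀ k l, 0 ≤ f k l)
    {a b δ B C P : ℝ} (ha : 0 < a) (hb : 0 < b) (hδ : 0 ≤ δ) (hC : 0 ≤ C) (hCB : C ≤ B)
    (h : RectSumAsymptotic f a b δ C B) (hP : 1 ≤ P) :
    |hyperbolicSum f a b P (P ^ a⁻¹) - C * P * Real.log P| ≤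
      B * P * (10 + 5 * Real.log P) := by
  have hB : 0 ≤ B := hC.trans hCB
  have hP0 : 0 < P := by linarith
  have hT0 : 0 ≤ Real.log P := Real.log_nonneg hP
  set T := Real.log P with hT
  have hN1 : 1 + T ≤ ⌈1 + T⌉₊ := Nat.le_ceil _
  have hN2 : (⌈1 + T⌉₊ : ℝ) ≤ T + 2 := by
    linarith [Nat.ceil_lt_add_one (a := 1 + T) (by positivity)]
  have hN0 : 0 < ⌈1 + T⌉₊ := Nat.ceil_pos.2 (by positivity)
  set N := ⌈1 + T⌉₊
  have hN0' : (0 : ℝ) < N := by exact_mod_cast hN0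
  have hmid := abs_hyperbolicSum_sub_le hf ha hb hδ hC hB h (P := P) le_rfl hT0
    (by simp [hT, Real.exp_log hP0]) hN0 (by linarith)
  have hone : hyperbolicSum f a b P 1 = rectSum f 1 (P ^ b⁻¹) := by
    simp [hyperbolicSum, rectSum]
  have hrect := h.abs_rectSum_le hδ hC hB le_rfl (Real.one_le_rpow hP (inv_nonneg.2 hb.le))
  rw [Real.one_rpow, one_mul, Real.rpow_inv_rpow hP0.le hb.ne'] at hrect
  rw [hone, Real.one_rpow, Real.one_rpow, mul_one, div_one] at hmid
  have h1 : T ^ 2 / N ≤ T := by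
    rw [div_le_iff₀ hN0']
    nlinarith
  have h2 : P * (C * (T ^ 2 / N) + 4 * N * B) ≤ P * (B * T + 4 * (T + 2) * B) := by gcongr
  have h3 : P * C ≤ P * B := by gcongr
  rw [abs_le] at *
  constructor <;> linarith [hmid.1, hmid.2, hrect.1, hrect.2]

/-- There is a power saving exponent that is small enough for both strips. -/
lemma exists_strip_exponent {a b α δ D : ℝ} (ha : 0 < a) (hb : 0 < b) (hα : 0 < α) (hδ : 0 < δ)
    (hD : 0 ≤ D) : ∃ μ : ℝ, 0 < μ ∧ μ * (a + b) ≤ 1 ∧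
      μ * b ≤ (1 - μ * a) * α ∧ μ * (1 + D) * b ≤ (1 - μ * a) * δ ∧
      μ * a ≤ (1 - μ * b) * α ∧ μ * (1 + D) * a ≤ (1 - μ * b) * δ := by
  have key : ∀ p q : ℝ, 0 < p → 0 < q → ∀ᶠ μ in nhdsWithin (0 : ℝ) (Set.Ioi 0), μ * q ≤ p := by
    intro p q hp hq
    have : Set.Ioo 0 (p / q) ∈ nhdsWithin (0 : ℝ) (Set.Ioi 0) :=
      Ioo_mem_nhdsGT (by positivity)
    filter_upwards [this] with μ hμ
    exact ((lt_div_iff₀ hq).1 hμ.2).le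
  have hev := (key 1 (a + b) one_pos (by positivity)).and
    ((key α (b + a * α) hα (by positivity)).and
    ((key δ ((1 + D) * b + a * δ) hδ (by positivity)).and
    ((key α (a + b * α) hα (by positivity)).and
    (key δ ((1 + D) * a + b * δ) hδ (by positivity)))))
  obtain ⟨μ, ⟨h1, h2, h3, h4, h5⟩, h0⟩ := (hev.and self_mem_nhdsWithin).exists
  exact ⟨μ, h0, h1, by linarith, by linarith, by linarith, by linarith⟩

lemma exists_abs_hyperbolicSum_sub_le {a b α δ D : ℝ} (ha : 0 < a) (hb : 0 < b) (hα : 0 < α)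
    (hδ : 0 < δ) (hD : 0 ≤ D) :
    ∃ κ : ℝ, 0 ≤ κ ∧ ∀ (f : ℕ → ℕ → ℝ) (c₁ c₂ : ℕ → ℝ) (B C y P : ℝ), (∀ k l, 0 ≤ f k l) →
      0 ≤ C → C ≤ B → RectSumAsymptotic f a b δ C B → RowSumAsymptotic f b α δ D B y c₁ →
      RowSumAsymptotic (fun l k ↦ f k l) a α δ D B y c₂ → 1 ≤ y → 1 ≤ P →
      |hyperbolicSum f a b P (P ^ a⁻¹) - C * P * Real.log P| ≤
        κ * B * y ^ δ * (1 + Real.log y) * P := by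
  obtain ⟨μ, hμ, hμab, hμ₁, hμ₁', hμ₂, hμ₂'⟩ := exists_strip_exponent ha hb hα hδ hD
  set κ₁ := 9 + (a + b) / δ + 8 * (1 + 2 / (μ * δ)) ^ 2 with hκ₁
  set κ₂ := 10 + 5 / μ with hκ₂
  have h1 : 0 ≤ κ₁ := by positivity
  have h2 : 0 ≤ κ₂ := by positivity
  refine ⟨κ₁ + κ₂, by positivity, ?_⟩
  intro f c₁ c₂ B C y P hf hC hCB h hr₁ hr₂ hy hP
  have hB : 0 ≤ B := hC.trans hCB
  have hP0 : 0 < P := by linarith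
  have hy0 : 0 < y := by linarith
  have hlogy : 0 ≤ Real.log y := Real.log_nonneg hy
  have hyδ : 1 ≤ y ^ δ := Real.one_le_rpow hy hδ.le
  rcases le_or_gt y (P ^ μ) with hyP | hyP
  · refine (abs_hyperbolicSum_sub_le_of_le_rpow hf ha hb hα hδ hD hC hCB h hr₁ hr₂ hμ hμab hμ₁
      hμ₁' hμ₂ hμ₂' hP hy hyP).trans ?_
    rw [← hκ₁]
    calc κ₁ * B * y ^ δ * P = (κ₁ + 0) * B * y ^ δ * (1 + 0) * P := by ring
      _ ≤ _ := by gcongr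
  · refine (abs_hyperbolicSum_sub_le_log hf ha hb hδ.le hC hCB h hP).trans ?_
    have hlog : Real.log P ≤ Real.log y / μ := by
      rw [le_div_iff₀' hμ, ← Real.log_rpow hP0]
      exact Real.log_le_log (by positivity) hyP.le
    have h3 : 10 + 5 * Real.log P ≤ κ₂ * (1 + Real.log y) := by
      have : 5 * Real.log P ≤ 5 / μ * Real.log y := by
        calc 5 * Real.log P ≤ 5 * (Real.log y / μ) := by gcongr
          _ = _ := by ring
      have : 0 ≤ 5 / μ := by positivity
      rw [hκ₂]
      linarith
    calc B * P * (10 + 5 * Real.log P) ≤ B * P * (κ₂ * (1 + Real.log y)) := by gcongr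
      _ = (0 + κ₂) * B * 1 * (1 + Real.log y) * P := by ring
      _ ≤ _ := by gcongr

end HyperbolaMethod

/-!
Statement 15: if `(f_d)_{d ≥ 1}` is a `(β₁,β₂,C_d,D,α,υ,δ)`-family of functions with
`C_d = O(d^υ)`, then uniformly for all integers `d ≥ 1` and all reals `P ≥ 2`:
`∑_{k,l ≥ 1, k^{β₁} l^{β₂} ≤ P} f_d(k,l) = C_d P log P + O(d^{υ+δ} (1 + log d) P)`.
-/
theorem statement15 (β₁ β₂ α δ D υ : ℝ)
    (hβ₁ : 0 < β₁) (hβ₂ : 0 < β₂) (hα : 0 < α) (hδ : 0 < δ) (hD : 0 ≤ D) (hυ : 0 ≤ υ)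
    (f : ℕ → ℕ → ℕ → ℝ) (C : ℕ → ℝ) (c₁ c₂ : ℕ → ℕ → ℝ)
    (hf0 : ∀ d k l, 0 ≤ f d k l) (hC0 : ∀ d, 0 ≤ C d)
    (hc₁0 : ∀ d k, 0 ≤ c₁ d k) (hc₂0 : ∀ d l, 0 ≤ c₂ d l)
    (hI : FamilyCondI β₁ β₂ υ δ f C)
    (hII₁ : FamilyCondII₁ β₂ α δ D υ f c₁)
    (hII₂ : FamilyCondII₂ β₁ α δ D υ f c₂)
    (hCd : ∃ C₀ : ℝ, ∀ d : ℕ, 1 ≤ d → C d ≤ C₀ * (d : ℝ) ^ υ) :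
    ∃ Cc : ℝ, 0 < Cc ∧ ∀ d : ℕ, 1 ≤ d → ∀ P : ℝ, 2 ≤ P →
      |(∑' kl : ℕ × ℕ,
          if 1 ≤ kl.1 ∧ 1 ≤ kl.2 ∧ (kl.1 : ℝ) ^ β₁ * (kl.2 : ℝ) ^ β₂ ≤ P then
            f d kl.1 kl.2 else 0) -
        C d * P * Real.log P| ≤
      Cc * (d : ℝ) ^ (υ + δ) * (1 + Real.log d) * P := by
  obtain ⟨κ, hκ, hmain⟩ := exists_abs_hyperbolicSum_sub_le hβ₁ hβ₂ hα hδ hD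
  obtain ⟨C₁, hI⟩ := hI
  obtain ⟨C₂, hII₁⟩ := hII₁
  obtain ⟨C₃, hII₂⟩ := hII₂
  obtain ⟨C₀, hCd⟩ := hCd
  set M := |C₀| + |C₁| + |C₂| + |C₃| with hM
  have hM0 : C₀ ≤ M := by
    linarith [le_abs_self C₀, abs_nonneg C₁, abs_nonneg C₂, abs_nonneg C₃]
  have hM1 : C₁ ≤ M := by
    linarith [abs_nonneg C₀, le_abs_self C₁, abs_nonneg C₂, abs_nonneg C₃]
  have hM2 : C₂ ≤ M := by
    linarith [abs_nonneg C₀, abs_nonneg C₁, le_abs_self C₂, abs_nonneg C₃]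
  have hM3 : C₃ ≤ M := by
    linarith [abs_nonneg C₀, abs_nonneg C₁, abs_nonneg C₂, le_abs_self C₃]
  have hMnn : 0 ≤ M := by positivity
  refine ⟨κ * M + 1, by positivity, fun d hd P hP ↦ ?_⟩
  have hd1 : (1 : ℝ) ≤ d := by exact_mod_cast hd
  have hd0 : (0 : ℝ) < d := by linarith
  have hP0 : 0 < P := by linarith
  rw [tsum_ite_eq_hyperbolicSum (f d) hβ₁ hβ₂ hP0.le]
  have hle : ∀ k x : ℝ, (d : ℝ) * k ≤ x → k ≤ (d : ℝ)⁻¹ * x := fun k x h ↦ by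
    rwa [le_inv_mul_iff₀ hd0]
  have hbd := hmain (f d) (c₁ d) (c₂ d) (M * (d : ℝ) ^ υ) (C d) d P (hf0 d) (hC0 d)
    ((hCd d hd).trans (by gcongr)) ?_ ?_ ?_ hd1 (by linarith)
  · refine hbd.trans ?_
    have hlog : 0 ≤ Real.log d := Real.log_nonneg hd1
    calc _ = κ * M * (d : ℝ) ^ (υ + δ) * (1 + Real.log d) * P := by
          rw [Real.rpow_add hd0]; ring
      _ ≤ _ := by gcongr; linarith
  · intro K L hK hL
    refine (hI d hd K L hK hL).trans ?_
    gcongr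
  · intro k hk L hL hkL
    refine (hII₁ d hd k hk L hL (hle _ _ hkL)).trans ?_
    rw [mul_right_comm M]
    gcongr
  · intro l hl K hK hlK
    refine (hII₂ d hd l hl K hK (hle _ _ hlK)).trans ?_
    rw [mul_right_comm M]
    gcongr
end
end

section
/- Let (f_d)_{d≥1} be a (β₁,β₂,C_d,D,α,υ,δ)-family of functions, with associated functions c_{d,1}, c_{d,2} as in condition (II). Then, uniformly for all integers d ≥ 1 and all K, L ≥ 1: ∑_{k≤K} c_{d,1}(k) = C_d·K^{β₁} + O(d^υ·K^{β₁−δ}) and ∑_{l≤L} c_{d,2}(l) = C_d·L^{β₂} + O(d^υ·L^{β₂−δ}). -/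
open scoped BigOperators

noncomputable section

/-- Condition (I) is symmetric under exchanging the two variables. -/
theorem FamilyCondI.swap {β₁ β₂ υ δ : ℝ} {f : ℕ → ℕ → ℕ → ℝ} {C : ℕ → ℝ}
    (h : FamilyCondI β₁ β₂ υ δ f C) :
    FamilyCondI β₂ β₁ υ δ (fun d l k => f d k l) C := by
  obtain ⟨C₁, h⟩ := h
  refine ⟨C₁, fun d hd L K hL hK => ?_⟩
  have hswap : boxSum (fun d l k => f d k l) d L K = boxSum f d K L := Finset.sum_comm
  rw [hswap, min_comm, mul_right_comm (C d), mul_right_comm (C₁ * (d : ℝ) ^ υ)]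
  exact h d hd K L hK hL

open Filter Topology in
/-- The coefficient `c₁ d k` is the limit of the normalised row sums of `f d k`. -/
theorem FamilyCondII₁.tendsto {β₂ α δ D υ : ℝ} {f : ℕ → ℕ → ℕ → ℝ} {c₁ : ℕ → ℕ → ℝ}
    (h : FamilyCondII₁ β₂ α δ D υ f c₁) (hα : 0 < α) (hδ : 0 < δ)
    {d : ℕ} (hd : 1 ≤ d) {k : ℕ} (hk : 1 ≤ k) :
    Tendsto (fun L : ℝ => (∑ l ∈ Finset.Icc 1 ⌊L⌋₊, f d k l) / L ^ β₂) atTop (𝓝 (c₁ d k)) := by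
  obtain ⟨C₂, h⟩ := h
  have hlarge : ∀ᶠ L : ℝ in atTop, (k : ℝ) ≤ (d : ℝ)⁻¹ * L ^ α :=
    ((tendsto_rpow_atTop hα).const_mul_atTop (by positivity)).eventually_ge_atTop _
  have hzero : Tendsto (fun L : ℝ => C₂ * (k : ℝ) ^ D * (d : ℝ) ^ υ * L ^ (-δ)) atTop (𝓝 0) := by
    simpa using (tendsto_rpow_neg_atTop hδ).const_mul (C₂ * (k : ℝ) ^ D * (d : ℝ) ^ υ)
  rw [tendsto_iff_norm_sub_tendsto_zero]
  refine squeeze_zero' (Eventually.of_forall fun _ => norm_nonneg _) ?_ hzero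
  filter_upwards [hlarge, eventually_ge_atTop 1] with L hkL hL
  have hL0 : 0 < L := by linarith
  have hpos : 0 < L ^ β₂ := Real.rpow_pos_of_pos hL0 _
  rw [Real.norm_eq_abs, div_sub' hpos.ne', abs_div, abs_of_pos hpos, div_le_iff₀ hpos,
    mul_assoc _ (L ^ (-δ)), ← Real.rpow_add hL0, mul_comm (L ^ β₂), neg_add_eq_sub]
  exact h d hd k hk L hL hkL

open Filter Topology in
/-- The summatory function of `c₁ d` is `C d * K ^ β₁ + O(d ^ υ * K ^ (β₁ - δ))`, uniformly in `d`. -/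
theorem FamilyCondI.exists_abs_sum_sub_le {β₁ β₂ α δ D υ : ℝ} {f : ℕ → ℕ → ℕ → ℝ} {C : ℕ → ℝ}
    {c₁ : ℕ → ℕ → ℝ} (hI : FamilyCondI β₁ β₂ υ δ f C) (hII : FamilyCondII₁ β₂ α δ D υ f c₁)
    (hα : 0 < α) (hδ : 0 < δ) :
    ∃ C₁ : ℝ, ∀ d : ℕ, 1 ≤ d → ∀ K : ℝ, 1 ≤ K →
      |(∑ k ∈ Finset.Icc 1 ⌊K⌋₊, c₁ d k) - C d * K ^ β₁| ≤ C₁ * (d : ℝ) ^ υ * K ^ (β₁ - δ) := by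
  obtain ⟨C₁, hI⟩ := hI
  refine ⟨C₁, fun d hd K hK => ?_⟩
  have hlim : Tendsto (fun L : ℝ => boxSum f d K L / L ^ β₂) atTop
      (𝓝 (∑ k ∈ Finset.Icc 1 ⌊K⌋₊, c₁ d k)) := by
    simp only [boxSum, Finset.sum_div (Finset.Icc 1 ⌊K⌋₊)]
    exact tendsto_finsetSum _ fun k hk => hII.tendsto hα hδ hd (Finset.mem_Icc.mp hk).1
  refine le_of_tendsto (hlim.sub_const (C d * K ^ β₁)).abs ?_
  filter_upwards [eventually_ge_atTop K] with L hKL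
  have hK0 : 0 < K := by linarith
  have hpos : 0 < L ^ β₂ := Real.rpow_pos_of_pos (by linarith) _
  have hbox := hI d hd K L hK (hK.trans hKL)
  rw [min_eq_left hKL] at hbox
  rw [div_sub' hpos.ne', abs_div, abs_of_pos hpos, div_le_iff₀ hpos, mul_comm (L ^ β₂),
    sub_eq_add_neg β₁, Real.rpow_add hK0]
  exact hbox.trans_eq (by ring)

/-!
Statement 16: if `(f_d)_{d ≥ 1}` is a `(β₁,β₂,C_d,D,α,υ,δ)`-family of functions with
associated functions `c_{d,1}, c_{d,2}` as in condition (II), then uniformly for all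
integers `d ≥ 1` and all `K, L ≥ 1`:
`∑_{k ≤ K} c_{d,1}(k) = C_d K^{β₁} + O(d^υ K^{β₁-δ})` and
`∑_{l ≤ L} c_{d,2}(l) = C_d L^{β₂} + O(d^υ L^{β₂-δ})`.
-/
theorem statement16 (β₁ β₂ α δ D υ : ℝ)
    (hβ₁ : 0 < β₁) (hβ₂ : 0 < β₂) (hα : 0 < α) (hδ : 0 < δ) (hD : 0 ≤ D) (hυ : 0 ≤ υ)
    (f : ℕ → ℕ → ℕ → ℝ) (C : ℕ → ℝ) (c₁ c₂ : ℕ → ℕ → ℝ)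
    (hf0 : ∀ d k l, 0 ≤ f d k l) (hC0 : ∀ d, 0 ≤ C d)
    (hc₁0 : ∀ d k, 0 ≤ c₁ d k) (hc₂0 : ∀ d l, 0 ≤ c₂ d l)
    (hI : FamilyCondI β₁ β₂ υ δ f C)
    (hII₁ : FamilyCondII₁ β₂ α δ D υ f c₁)
    (hII₂ : FamilyCondII₂ β₁ α δ D υ f c₂) :
    ∃ Cc : ℝ, 0 < Cc ∧ ∀ d : ℕ, 1 ≤ d →
      (∀ K : ℝ, 1 ≤ K →
        |(∑ k ∈ Finset.Icc 1 ⌊K⌋₊, c₁ d k) - C d * K ^ β₁| ≤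
          Cc * (d : ℝ) ^ υ * K ^ (β₁ - δ)) ∧
      (∀ L : ℝ, 1 ≤ L →
        |(∑ l ∈ Finset.Icc 1 ⌊L⌋₊, c₂ d l) - C d * L ^ β₂| ≤
          Cc * (d : ℝ) ^ υ * L ^ (β₂ - δ)) := by
  obtain ⟨A, hA⟩ := hI.exists_abs_sum_sub_le hII₁ hα hδ
  have hII₂' : FamilyCondII₁ β₁ α δ D υ (fun d l k => f d k l) c₂ := hII₂
  obtain ⟨B, hB⟩ := hI.swap.exists_abs_sum_sub_le hII₂' hα hδ
  refine ⟨max 1 (max A B), by positivity, fun d hd => ⟨fun K hK => ?_, fun L hL => ?_⟩⟩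
  · refine (hA d hd K hK).trans ?_
    gcongr
    exact (le_max_left A B).trans (le_max_right 1 _)
  · refine (hB d hd L hL).trans ?_
    gcongr
    exact (le_max_right A B).trans (le_max_right 1 _)
end
end

section
/- Let (f_d)_{d≥1} be a (β₁,β₂,C_d,D,α,υ,δ)-family of functions with C_d = O(d^υ), and let μ be a real number satisfying 0 < β₁μ < 1/2, μ·(1 + αβ₁/β₂) ≤ α/β₂, and μ·(D − β₁ + 1 + δβ₁/β₂) < δ/(2β₂). Then, uniformly for all integers d ≥ 1 and all P ≥ 2: T_{d,1} := ∑_{1 ≤ k ≤ d^{−1}·P^{μ}} ∑_{l : P^{1/2} < l^{β₂} ≤ P/k^{β₁}} f_d(k,l) = β₁·μ·C_d·P·log P + O(d^{υ+δ}·(1 + log d)·P). -/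
open scoped BigOperators

noncomputable section

/-- Abel summation with weight `k ^ (-β)` against a power asymptotic for the partial sums. -/
theorem abs_sum_mul_rpow_neg_sub_log_le {β δ A E : ℝ} (hβ : 0 < β) (hδ : 0 < δ) (hE : 0 ≤ E)
    (c : ℕ → ℝ)
    (hc : ∀ K : ℝ, 1 ≤ K → |∑ k ∈ Finset.Icc 1 ⌊K⌋₊, c k - A * K ^ β| ≤ E * K ^ (β - δ))
    {K : ℝ} (hK : 1 ≤ K) :
    |∑ k ∈ Finset.Icc 1 ⌊K⌋₊, (k : ℝ) ^ (-β) * c k - β * A * Real.log K| ≤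
      |A| + E * (1 + β / δ) := by
  set c' : ℕ → ℝ := fun k => if 1 ≤ k then c k else 0 with hc'
  have hsum : ∀ (g : ℕ → ℝ) (n : ℕ),
      ∑ k ∈ Finset.Icc 0 n, g k * c' k = ∑ k ∈ Finset.Icc 1 n, g k * c k := by
    intro g n
    rw [← Finset.sum_subset (Finset.Icc_subset_Icc_left zero_le_one)]
    · refine Finset.sum_congr rfl fun k hk => ?_
      simp [hc', (Finset.mem_Icc.mp hk).1]
    · intro k hk hk'
      have : ¬ 1 ≤ k := by simp only [Finset.mem_Icc] at hk hk'; omega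
      simp [hc', this]
  have hsum1 : ∀ n : ℕ, ∑ k ∈ Finset.Icc 0 n, c' k = ∑ k ∈ Finset.Icc 1 n, c k := by
    intro n; simpa using hsum (fun _ => 1) n
  have hderiv : ∀ t : ℝ, 0 < t →
      HasDerivAt (fun t : ℝ => t ^ (-β)) (-β * t ^ (-β - 1)) t := fun t ht => by
    simpa using Real.hasDerivAt_rpow_const (p := -β) (Or.inl ht.ne')
  have hcont : ∀ p : ℝ, ContinuousOn (fun t : ℝ => t ^ p) (Set.Icc 1 K) := fun p =>
    continuousOn_id.rpow_const fun t ht => Or.inl (by have := ht.1; simp only [id]; positivity)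
  have hderivInt : MeasureTheory.IntegrableOn (deriv fun t : ℝ => t ^ (-β)) (Set.Icc 1 K) := by
    refine MeasureTheory.IntegrableOn.congr_fun
      ((continuousOn_const.mul (hcont (-β - 1))).integrableOn_Icc (f := fun t => -β * t ^ (-β - 1)))
      (fun t ht => ?_) measurableSet_Icc
    exact (hderiv t (by linarith [ht.1])).deriv.symm
  have habel := sum_mul_eq_sub_integral_mul₀ (f := fun t : ℝ => t ^ (-β)) c' (by simp [hc']) K
    (fun t ht => (hderiv t (by linarith [ht.1])).differentiableAt) hderivInt
  rw [hsum (fun k => (k : ℝ) ^ (-β)), hsum1, ← intervalIntegral.integral_of_le hK] at habel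
  have hgint : IntervalIntegrable
      (fun t => deriv (fun t : ℝ => t ^ (-β)) t * ∑ k ∈ Finset.Icc 0 ⌊t⌋₊, c' k)
      MeasureTheory.volume 1 K :=
    (intervalIntegrable_iff_integrableOn_Icc_of_le hK).2
      (integrableOn_mul_sum_Icc c' zero_le_one hderivInt)
  have h0 : (0 : ℝ) ∉ Set.uIcc 1 K := by
    rw [Set.uIcc_of_le hK]; intro h; linarith [h.1]
  have hhint : IntervalIntegrable (fun t : ℝ => -(β * A) * t⁻¹) MeasureTheory.volume 1 K := by
    refine IntervalIntegrable.const_mul ?_ _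
    exact intervalIntegral.intervalIntegrable_inv (fun x hx h => h0 (h ▸ hx)) continuousOn_id
  have hbd : ‖∫ t in (1 : ℝ)..K,
        (deriv (fun t : ℝ => t ^ (-β)) t * ∑ k ∈ Finset.Icc 0 ⌊t⌋₊, c' k - -(β * A) * t⁻¹)‖ ≤
      ∫ t in (1 : ℝ)..K, β * E * t ^ (-1 - δ) := by
    refine intervalIntegral.norm_integral_le_of_norm_le hK (Filter.Eventually.of_forall ?_) ?_
    · intro t ht
      have ht0 : 0 < t := by linarith [ht.1]
      rw [(hderiv t ht0).deriv, hsum1]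
      have h1 : t⁻¹ = t ^ (-β - 1) * t ^ β := by
        rw [← Real.rpow_add ht0, ← Real.rpow_neg_one]; congr 1; ring
      have h2 : t ^ (-1 - δ) = t ^ (-β - 1) * t ^ (β - δ) := by
        rw [← Real.rpow_add ht0]; congr 1; ring
      have h3 : -β * t ^ (-β - 1) * ∑ k ∈ Finset.Icc 1 ⌊t⌋₊, c k - -(β * A) * t⁻¹ =
          -(β * t ^ (-β - 1)) * (∑ k ∈ Finset.Icc 1 ⌊t⌋₊, c k - A * t ^ β) := by rw [h1]; ring
      rw [h3, Real.norm_eq_abs, abs_mul, abs_neg, abs_of_nonneg (by positivity), h2]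
      calc _ ≤ β * t ^ (-β - 1) * (E * t ^ (β - δ)) := by gcongr; exact hc t ht.1.le
        _ = _ := by ring
    · refine IntervalIntegrable.const_mul ?_ _
      exact intervalIntegral.intervalIntegrable_rpow (Or.inr h0)
  rw [intervalIntegral.integral_sub hgint hhint, intervalIntegral.integral_const_mul,
    intervalIntegral.integral_const_mul, integral_inv h0, div_one,
    integral_rpow (Or.inr ⟨by linarith, h0⟩), Real.one_rpow, Real.norm_eq_abs] at hbd
  have hK0 : 0 < K := by linarith
  have hbd' : β * E * ((K ^ (-1 - δ + 1) - 1) / (-1 - δ + 1)) ≤ E * (β / δ) := by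
    have : (K ^ (-1 - δ + 1) - 1) / (-1 - δ + 1) ≤ 1 / δ := by
      rw [show -1 - δ + 1 = -δ by ring, div_neg, ← neg_div]
      gcongr
      linarith [Real.rpow_nonneg hK0.le (-δ)]
    calc _ ≤ β * E * (1 / δ) := by gcongr
      _ = _ := by ring
  have hend : |K ^ (-β) * ∑ k ∈ Finset.Icc 1 ⌊K⌋₊, c k - A| ≤ E := by
    have h1 : K ^ (-β) * K ^ β = 1 := by rw [← Real.rpow_add hK0]; simp
    have h2 : K ^ (-β) * ∑ k ∈ Finset.Icc 1 ⌊K⌋₊, c k - A =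
        K ^ (-β) * (∑ k ∈ Finset.Icc 1 ⌊K⌋₊, c k - A * K ^ β) := by
      linear_combination A * h1
    rw [h2, abs_mul, abs_of_nonneg (by positivity)]
    calc _ ≤ K ^ (-β) * (E * K ^ (β - δ)) := by gcongr; exact hc K hK
      _ = E * K ^ (-δ) := by
        rw [mul_left_comm, ← Real.rpow_add hK0]; congr 2; ring
      _ ≤ E * 1 := by gcongr; exact Real.rpow_le_one_of_one_le_of_nonpos hK (by linarith)
      _ = E := mul_one E
  rw [habel]
  have := le_abs_self A
  have := neg_abs_le A
  rw [abs_le] at hend hbd ⊢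
  constructor <;> linarith [hend.1, hend.2, hbd.1, hbd.2]

/-- Letting `L → ∞` in conditions (I) and (II) gives the asymptotics of the partial sums of the
coefficients in (II). -/
theorem abs_sum_coeff_sub_le {β₁ β₂ α δ D υ C₁ : ℝ}
    (hα : 0 < α) (hδ : 0 < δ)
    {f : ℕ → ℕ → ℕ → ℝ} {C : ℕ → ℝ} {c₁ : ℕ → ℕ → ℝ}
    (hI : ∀ d : ℕ, 1 ≤ d → ∀ K L : ℝ, 1 ≤ K → 1 ≤ L →
      |boxSum f d K L - C d * K ^ β₁ * L ^ β₂| ≤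
        C₁ * (d : ℝ) ^ υ * K ^ β₁ * L ^ β₂ * (min K L) ^ (-δ))
    (hII₁ : FamilyCondII₁ β₂ α δ D υ f c₁) {d : ℕ} (hd : 1 ≤ d) {K : ℝ} (hK : 1 ≤ K) :
    |∑ k ∈ Finset.Icc 1 ⌊K⌋₊, c₁ d k - C d * K ^ β₁| ≤ C₁ * (d : ℝ) ^ υ * K ^ (β₁ - δ) := by
  obtain ⟨C₂, hII⟩ := hII₁
  have hd0 : (0 : ℝ) < d := by exact_mod_cast hd
  have hlim : ∀ k ∈ Finset.Icc 1 ⌊K⌋₊, Filter.Tendsto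
      (fun L : ℝ => (∑ l ∈ Finset.Icc 1 ⌊L⌋₊, f d k l) / L ^ β₂) Filter.atTop
      (nhds (c₁ d k)) := by
    intro k hk
    rw [tendsto_iff_norm_sub_tendsto_zero]
    have h0 : Filter.Tendsto (fun L : ℝ => C₂ * (k : ℝ) ^ D * (d : ℝ) ^ υ * L ^ (-δ))
        Filter.atTop (nhds 0) := by
      simpa using (tendsto_rpow_neg_atTop hδ).const_mul (C₂ * (k : ℝ) ^ D * (d : ℝ) ^ υ)
    refine squeeze_zero' (Filter.Eventually.of_forall fun _ => norm_nonneg _) ?_ h0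
    filter_upwards [Filter.eventually_ge_atTop 1,
      (tendsto_rpow_atTop hα).eventually_ge_atTop (d * k : ℝ)] with L hL hL'
    have hL0 : 0 < L := by linarith
    have hLp : 0 < L ^ β₂ := by positivity
    have h1 := hII d hd k (Finset.mem_Icc.mp hk).1 L hL (by
      rw [inv_mul_eq_div, le_div_iff₀ hd0]; linarith)
    have h2 : (∑ l ∈ Finset.Icc 1 ⌊L⌋₊, f d k l) / L ^ β₂ - c₁ d k =
        ((∑ l ∈ Finset.Icc 1 ⌊L⌋₊, f d k l) - c₁ d k * L ^ β₂) / L ^ β₂ := by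
      field_simp
    rw [Real.norm_eq_abs, h2, abs_div, abs_of_pos hLp, div_le_iff₀ hLp, mul_assoc _ (L ^ (-δ)),
      ← Real.rpow_add hL0, neg_add_eq_sub]
    exact h1
  have hlim' := ((tendsto_finsetSum _ hlim).sub_const (C d * K ^ β₁)).abs
  refine le_of_tendsto hlim' ?_
  filter_upwards [Filter.eventually_ge_atTop K] with L hL
  have hL0 : 0 < L := by linarith
  have hLp : 0 < L ^ β₂ := by positivity
  have h1 := hI d hd K L hK (hK.trans hL)
  have h2 : ∑ k ∈ Finset.Icc 1 ⌊K⌋₊, (∑ l ∈ Finset.Icc 1 ⌊L⌋₊, f d k l) / L ^ β₂ - C d * K ^ β₁ =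
      (boxSum f d K L - C d * K ^ β₁ * L ^ β₂) / L ^ β₂ := by
    rw [← Finset.sum_div, boxSum]; field_simp
  rw [h2, abs_div, abs_of_pos hLp, div_le_iff₀ hLp]
  refine h1.trans_eq ?_
  rw [min_eq_left hL, sub_eq_add_neg, Real.rpow_add (by linarith)]
  ring

theorem sum_rpow_le {e s K : ℝ} (hs : e + 1 ≤ s) (hs0 : 0 ≤ s) (hK : 1 ≤ K) :
    ∑ k ∈ Finset.Icc 1 ⌊K⌋₊, (k : ℝ) ^ e ≤ K ^ s * (1 + Real.log K) := by
  have hharm := harmonic_floor_le_one_add_log K hK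
  rw [harmonic_eq_sum_Icc] at hharm
  push_cast at hharm
  calc ∑ k ∈ Finset.Icc 1 ⌊K⌋₊, (k : ℝ) ^ e ≤ ∑ k ∈ Finset.Icc 1 ⌊K⌋₊, K ^ s * (k : ℝ)⁻¹ := by
        refine Finset.sum_le_sum fun k hk => ?_
        obtain ⟨hk1, hk2⟩ := Finset.mem_Icc.mp hk
        have hk1' : (1 : ℝ) ≤ k := by exact_mod_cast hk1
        have hkK : (k : ℝ) ≤ K := (Nat.le_floor_iff (by linarith)).mp hk2
        calc (k : ℝ) ^ e ≤ (k : ℝ) ^ (s - 1) :=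
              Real.rpow_le_rpow_of_exponent_le hk1' (by linarith)
          _ = (k : ℝ) ^ s * (k : ℝ)⁻¹ := by
              rw [Real.rpow_sub_one (by positivity), div_eq_mul_inv]
          _ ≤ K ^ s * (k : ℝ)⁻¹ := by gcongr
    _ = K ^ s * ∑ k ∈ Finset.Icc 1 ⌊K⌋₊, (k : ℝ)⁻¹ := by rw [Finset.mul_sum]
    _ ≤ K ^ s * (1 + Real.log K) := by gcongr

theorem tsum_ite_eq_sum_sub_boxSum {f : ℕ → ℕ → ℕ → ℝ} {β₁ β₂ : ℝ} (hβ₁ : 0 < β₁) (hβ₂ : 0 < β₂)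
    {P K Q : ℝ} (hP : 0 < P) (hQ : 0 < Q) (hK : 0 ≤ K) (hKP : Q * K ^ β₁ ≤ P) (d : ℕ) :
    (∑' kl : ℕ × ℕ,
      if 1 ≤ kl.1 ∧ (kl.1 : ℝ) ≤ K ∧
          Q < (kl.2 : ℝ) ^ β₂ ∧ (kl.2 : ℝ) ^ β₂ ≤ P / (kl.1 : ℝ) ^ β₁ then
        f d kl.1 kl.2 else 0) =
      ∑ k ∈ Finset.Icc 1 ⌊K⌋₊, ∑ l ∈ Finset.Icc 1 ⌊(P / (k : ℝ) ^ β₁) ^ β₂⁻¹⌋₊, f d k l -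
        boxSum f d K (Q ^ β₂⁻¹) := by
  have hlt : ∀ l : ℕ, Q < (l : ℝ) ^ β₂ ↔ ⌊Q ^ β₂⁻¹⌋₊ < l := fun l => by
    rw [Nat.floor_lt (by positivity), Real.rpow_inv_lt_iff_of_pos hQ.le (by positivity) hβ₂]
  have hle : ∀ k l : ℕ, (l : ℝ) ^ β₂ ≤ P / (k : ℝ) ^ β₁ ↔ l ≤ ⌊(P / (k : ℝ) ^ β₁) ^ β₂⁻¹⌋₊ :=
    fun k l => by
      rw [Nat.le_floor_iff (by positivity),
        Real.le_rpow_inv_iff_of_pos (by positivity) (by positivity) hβ₂]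
  set S : Finset (ℕ × ℕ) := (Finset.Icc 1 ⌊K⌋₊).biUnion fun k =>
    (Finset.Ioc ⌊Q ^ β₂⁻¹⌋₊ ⌊(P / (k : ℝ) ^ β₁) ^ β₂⁻¹⌋₊).map ⟨Prod.mk k, Prod.mk_right_injective k⟩
    with hS
  have hmem : ∀ kl : ℕ × ℕ, (1 ≤ kl.1 ∧ (kl.1 : ℝ) ≤ K ∧
      Q < (kl.2 : ℝ) ^ β₂ ∧ (kl.2 : ℝ) ^ β₂ ≤ P / (kl.1 : ℝ) ^ β₁) ↔ kl ∈ S := by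
    rintro ⟨k, l⟩
    simp only [hlt, hle, hS, Finset.mem_biUnion, Finset.mem_map, Finset.mem_Icc, Finset.mem_Ioc,
      Function.Embedding.coeFn_mk, Prod.mk.injEq, Nat.le_floor_iff hK]
    constructor
    · rintro ⟨h1, h2, h3, h4⟩
      exact ⟨k, ⟨h1, h2⟩, l, ⟨h3, h4⟩, rfl, rfl⟩
    · rintro ⟨k', ⟨h1, h2⟩, l', ⟨h3, h4⟩, rfl, rfl⟩
      exact ⟨h1, h2, h3, h4⟩
  simp only [hmem]
  rw [tsum_eq_sum (s := S) (fun kl hkl => if_neg hkl), Finset.sum_congr rfl fun kl hkl => if_pos hkl,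
    hS, Finset.sum_biUnion, boxSum, ← Finset.sum_sub_distrib]
  · refine Finset.sum_congr rfl fun k hk => ?_
    obtain ⟨hk1, hk2⟩ := Finset.mem_Icc.mp hk
    have hkK : (k : ℝ) ≤ K := (Nat.le_floor_iff hK).mp hk2
    have hk0 : (0 : ℝ) < k := by exact_mod_cast hk1
    rw [Finset.sum_map, eq_sub_iff_add_eq']
    have hfl : ⌊Q ^ β₂⁻¹⌋₊ ≤ ⌊(P / (k : ℝ) ^ β₁) ^ β₂⁻¹⌋₊ := by
      refine Nat.floor_le_floor (Real.rpow_le_rpow hQ.le ?_ (by positivity))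
      rw [le_div_iff₀ (by positivity)]
      refine le_trans ?_ hKP
      gcongr
    simpa [← Finset.Icc_add_one_left_eq_Ioc 0] using
      Finset.sum_Ioc_consecutive (fun l => f d k l) (Nat.zero_le _) hfl
  · intro a _ b _ hab
    simp only [Function.onFun, Finset.disjoint_left, Finset.mem_map, Function.Embedding.coeFn_mk]
    rintro _ ⟨x, _, rfl⟩ ⟨y, _, h⟩
    exact hab (Prod.ext_iff.mp h).1.symm

/-- Replacing each inner sum in the `k`-th row by its main term from condition (II). -/
theorem abs_sum_sub_main_le {β₁ β₂ α δ D υ μ C₂ : ℝ} (hβ₁ : 0 < β₁) (hβ₂ : 0 < β₂) (hα : 0 < α)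
    (hδ : 0 < δ) (hC₂ : 0 ≤ C₂) {f : ℕ → ℕ → ℕ → ℝ} {c₁ : ℕ → ℕ → ℝ}
    (hII : ∀ d : ℕ, 1 ≤ d → ∀ k : ℕ, 1 ≤ k → ∀ L : ℝ, 1 ≤ L →
      (k : ℝ) ≤ (d : ℝ)⁻¹ * L ^ α →
      |(∑ l ∈ Finset.Icc 1 ⌊L⌋₊, f d k l) - c₁ d k * L ^ β₂| ≤
        C₂ * (k : ℝ) ^ D * (d : ℝ) ^ υ * L ^ (β₂ - δ))
    (hμ : 0 < μ) (hμ1' : β₁ * μ < 1 / 2)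
    (hμ2 : μ * (1 + α * β₁ / β₂) ≤ α / β₂)
    (hμ3 : μ * (D - β₁ + 1 + δ * β₁ / β₂) < δ / (2 * β₂))
    {d : ℕ} (hd : 1 ≤ d) {P : ℝ} (hP : 2 ≤ P) (hK : 1 ≤ (d : ℝ)⁻¹ * P ^ μ) :
    |∑ k ∈ Finset.Icc 1 ⌊(d : ℝ)⁻¹ * P ^ μ⌋₊,
        ∑ l ∈ Finset.Icc 1 ⌊(P / (k : ℝ) ^ β₁) ^ β₂⁻¹⌋₊, f d k l -
      P * ∑ k ∈ Finset.Icc 1 ⌊(d : ℝ)⁻¹ * P ^ μ⌋₊, (k : ℝ) ^ (-β₁) * c₁ d k| ≤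
    C₂ * (1 + μ / (δ / (2 * β₂))) * ((d : ℝ) ^ υ * P) := by
  have hd1 : (1 : ℝ) ≤ d := by exact_mod_cast hd
  have hd0 : (0 : ℝ) < d := by linarith
  have hP0 : 0 < P := by linarith
  have hP1 : 1 ≤ P := by linarith
  set K := (d : ℝ)⁻¹ * P ^ μ with hKdef
  set ε := δ / (2 * β₂) with hε
  have hε0 : 0 < ε := by positivity
  have hKP : K ≤ P ^ μ := by
    rw [hKdef, inv_mul_eq_div]; exact div_le_self (by positivity) hd1
  set e := D - β₁ + δ * β₁ / β₂ with he
  set s := max (e + 1) 0 with hs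
  have hμs : μ * s ≤ ε := by
    rcases max_cases (e + 1) 0 with h | h
    · rw [hs, h.1, he]; linarith
    · rw [hs, h.1]; linarith
  have hterm : ∀ k ∈ Finset.Icc 1 ⌊K⌋₊,
      |∑ l ∈ Finset.Icc 1 ⌊(P / (k : ℝ) ^ β₁) ^ β₂⁻¹⌋₊, f d k l -
        P * ((k : ℝ) ^ (-β₁) * c₁ d k)| ≤
        C₂ * (d : ℝ) ^ υ * P ^ (1 - δ / β₂) * (k : ℝ) ^ e := by
    intro k hk
    obtain ⟨hk1, hk2⟩ := Finset.mem_Icc.mp hk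
    have hkK : (k : ℝ) ≤ K := (Nat.le_floor_iff (by linarith)).mp hk2
    have hk1' : (1 : ℝ) ≤ k := by exact_mod_cast hk1
    have hk0 : (0 : ℝ) < k := by linarith
    have hkβ : (k : ℝ) ^ β₁ ≤ P ^ (β₁ * μ) := by
      rw [mul_comm, Real.rpow_mul hP0.le]
      exact Real.rpow_le_rpow hk0.le (hkK.trans hKP) hβ₁.le
    set X := P / (k : ℝ) ^ β₁ with hX
    have hXP : P ^ (1 - β₁ * μ) ≤ X := by
      rw [Real.rpow_sub hP0, Real.rpow_one, hX]; gcongr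
    have hX1 : 1 ≤ X := (Real.one_le_rpow hP1 (by linarith)).trans hXP
    have hX0 : 0 < X := by linarith
    have hL1 : 1 ≤ X ^ β₂⁻¹ := Real.one_le_rpow hX1 (by positivity)
    have hrange : (k : ℝ) ≤ (d : ℝ)⁻¹ * (X ^ β₂⁻¹) ^ α := by
      refine hkK.trans ?_
      rw [hKdef, ← Real.rpow_mul hX0.le]
      gcongr
      calc P ^ μ ≤ P ^ ((1 - β₁ * μ) * (β₂⁻¹ * α)) := by
            refine Real.rpow_le_rpow_of_exponent_le hP1 ?_
            have h1 : (1 - β₁ * μ) * (β₂⁻¹ * α) = α / β₂ - μ * (α * β₁ / β₂) := by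
              field_simp
            rw [h1]; linarith
        _ = (P ^ (1 - β₁ * μ)) ^ (β₂⁻¹ * α) := Real.rpow_mul hP0.le _ _
        _ ≤ X ^ (β₂⁻¹ * α) := by gcongr
    have h := hII d hd k hk1 _ hL1 hrange
    rw [← Real.rpow_mul hX0.le, ← Real.rpow_mul hX0.le, inv_mul_cancel₀ hβ₂.ne',
      Real.rpow_one] at h
    have h1 : P * ((k : ℝ) ^ (-β₁) * c₁ d k) = c₁ d k * X := by
      rw [hX, Real.rpow_neg hk0.le, div_eq_mul_inv]; ring
    have h2 : β₂⁻¹ * (β₂ - δ) = 1 - δ / β₂ := by field_simp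
    have h3 : X ^ (1 - δ / β₂) = P ^ (1 - δ / β₂) * (k : ℝ) ^ (-β₁ + δ * β₁ / β₂) := by
      rw [hX, Real.div_rpow hP0.le (by positivity), ← Real.rpow_mul hk0.le, div_eq_mul_inv,
        ← Real.rpow_neg hk0.le]
      congr 2; ring
    have h4 : (k : ℝ) ^ e = (k : ℝ) ^ D * (k : ℝ) ^ (-β₁ + δ * β₁ / β₂) := by
      rw [← Real.rpow_add hk0, he]; congr 1; ring
    rw [h1]
    refine h.trans_eq ?_
    rw [h2, h3, h4]; ring
  rw [Finset.mul_sum, ← Finset.sum_sub_distrib]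
  have hlogK : Real.log K ≤ μ * (P ^ ε / ε) := by
    calc Real.log K ≤ Real.log (P ^ μ) := Real.log_le_log (by linarith) hKP
      _ = μ * Real.log P := Real.log_rpow hP0 μ
      _ ≤ _ := by gcongr; exact Real.log_le_rpow_div hP0.le hε0
  have hPε : 1 ≤ P ^ ε := Real.one_le_rpow hP1 hε0.le
  have hKs : K ^ s ≤ P ^ ε := by
    calc K ^ s ≤ (P ^ μ) ^ s := Real.rpow_le_rpow (by linarith) hKP (le_max_right _ _)
      _ = P ^ (μ * s) := (Real.rpow_mul hP0.le _ _).symm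
      _ ≤ P ^ ε := Real.rpow_le_rpow_of_exponent_le hP1 hμs
  have hlog0 : 0 ≤ Real.log K := Real.log_nonneg hK
  calc _ ≤ ∑ k ∈ Finset.Icc 1 ⌊K⌋₊, C₂ * (d : ℝ) ^ υ * P ^ (1 - δ / β₂) * (k : ℝ) ^ e :=
        (Finset.abs_sum_le_sum_abs _ _).trans (Finset.sum_le_sum hterm)
    _ = C₂ * (d : ℝ) ^ υ * P ^ (1 - δ / β₂) * ∑ k ∈ Finset.Icc 1 ⌊K⌋₊, (k : ℝ) ^ e := by
        rw [Finset.mul_sum]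
    _ ≤ C₂ * (d : ℝ) ^ υ * P ^ (1 - δ / β₂) * (K ^ s * (1 + Real.log K)) := by
        gcongr
        exact sum_rpow_le (le_max_left _ _) (le_max_right _ _) hK
    _ ≤ C₂ * (d : ℝ) ^ υ * P ^ (1 - δ / β₂) * (P ^ ε * (P ^ ε + μ * (P ^ ε / ε))) := by
        gcongr
    _ = C₂ * (1 + μ / ε) * ((d : ℝ) ^ υ * (P ^ (1 - δ / β₂) * P ^ ε * P ^ ε)) := by ring
    _ = C₂ * (1 + μ / ε) * ((d : ℝ) ^ υ * P) := by
        rw [← Real.rpow_add hP0, ← Real.rpow_add hP0]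
        have : 1 - δ / β₂ + ε + ε = 1 := by rw [hε]; field_simp; ring
        rw [this, Real.rpow_one]

/-!
Statement 17: if `(f_d)_{d ≥ 1}` is a `(β₁,β₂,C_d,D,α,υ,δ)`-family with `C_d = O(d^υ)`
and `μ` satisfies `0 < β₁ μ < 1/2`, `μ (1 + α β₁/β₂) ≤ α/β₂` and
`μ (D - β₁ + 1 + δ β₁/β₂) < δ/(2β₂)`, then uniformly for all `d ≥ 1` and `P ≥ 2`:
`T_{d,1} = ∑_{1 ≤ k ≤ d⁻¹ P^μ} ∑_{P^{1/2} < l^{β₂} ≤ P/k^{β₁}} f_d(k,l)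
        = β₁ μ C_d P log P + O(d^{υ+δ} (1 + log d) P)`.
-/
theorem statement17 (β₁ β₂ α δ D υ : ℝ)
    (hβ₁ : 0 < β₁) (hβ₂ : 0 < β₂) (hα : 0 < α) (hδ : 0 < δ) (hD : 0 ≤ D) (hυ : 0 ≤ υ)
    (f : ℕ → ℕ → ℕ → ℝ) (C : ℕ → ℝ) (c₁ c₂ : ℕ → ℕ → ℝ)
    (hf0 : ∀ d k l, 0 ≤ f d k l) (hC0 : ∀ d, 0 ≤ C d)
    (hc₁0 : ∀ d k, 0 ≤ c₁ d k) (hc₂0 : ∀ d l, 0 ≤ c₂ d l)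
    (hI : FamilyCondI β₁ β₂ υ δ f C)
    (hII₁ : FamilyCondII₁ β₂ α δ D υ f c₁)
    (hII₂ : FamilyCondII₂ β₁ α δ D υ f c₂)
    (hCd : ∃ C₀ : ℝ, ∀ d : ℕ, 1 ≤ d → C d ≤ C₀ * (d : ℝ) ^ υ)
    (μ : ℝ) (hμ1 : 0 < β₁ * μ) (hμ1' : β₁ * μ < 1 / 2)
    (hμ2 : μ * (1 + α * β₁ / β₂) ≤ α / β₂)
    (hμ3 : μ * (D - β₁ + 1 + δ * β₁ / β₂) < δ / (2 * β₂)) :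
    ∃ Cc : ℝ, 0 < Cc ∧ ∀ d : ℕ, 1 ≤ d → ∀ P : ℝ, 2 ≤ P →
      |(∑' kl : ℕ × ℕ,
          if 1 ≤ kl.1 ∧ (kl.1 : ℝ) ≤ (d : ℝ)⁻¹ * P ^ μ ∧
              P ^ (1/2 : ℝ) < (kl.2 : ℝ) ^ β₂ ∧ (kl.2 : ℝ) ^ β₂ ≤ P / (kl.1 : ℝ) ^ β₁ then
            f d kl.1 kl.2 else 0) -
        β₁ * μ * C d * P * Real.log P| ≤
      Cc * (d : ℝ) ^ (υ + δ) * (1 + Real.log d) * P := by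
  obtain ⟨C₁', hI'⟩ := hI
  obtain ⟨C₂', hII'⟩ := id hII₁
  obtain ⟨C₀', hC₀'⟩ := hCd
  obtain ⟨C₁, hC₁, hI⟩ : ∃ C₁ : ℝ, 0 ≤ C₁ ∧ ∀ d : ℕ, 1 ≤ d → ∀ K L : ℝ, 1 ≤ K → 1 ≤ L →
      |boxSum f d K L - C d * K ^ β₁ * L ^ β₂| ≤
        C₁ * (d : ℝ) ^ υ * K ^ β₁ * L ^ β₂ * (min K L) ^ (-δ) := by
    refine ⟨max C₁' 0, le_max_right _ _, fun d hd K L hK hL => (hI' d hd K L hK hL).trans ?_⟩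
    have : 0 ≤ min K L := le_min (by linarith) (by linarith)
    gcongr
    exact le_max_left _ _
  obtain ⟨C₂, hC₂, hII⟩ : ∃ C₂ : ℝ, 0 ≤ C₂ ∧ ∀ d : ℕ, 1 ≤ d → ∀ k : ℕ, 1 ≤ k → ∀ L : ℝ, 1 ≤ L →
      (k : ℝ) ≤ (d : ℝ)⁻¹ * L ^ α →
      |(∑ l ∈ Finset.Icc 1 ⌊L⌋₊, f d k l) - c₁ d k * L ^ β₂| ≤
        C₂ * (k : ℝ) ^ D * (d : ℝ) ^ υ * L ^ (β₂ - δ) := by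
    refine ⟨max C₂' 0, le_max_right _ _, fun d hd k hk L hL h => (hII' d hd k hk L hL h).trans ?_⟩
    gcongr
    exact le_max_left _ _
  obtain ⟨C₀, hC₀, hC⟩ : ∃ C₀ : ℝ, 0 ≤ C₀ ∧ ∀ d : ℕ, 1 ≤ d → C d ≤ C₀ * (d : ℝ) ^ υ := by
    refine ⟨max C₀' 0, le_max_right _ _, fun d hd => (hC₀' d hd).trans ?_⟩
    gcongr
    exact le_max_left _ _
  have hμ : 0 < μ := pos_of_mul_pos_right hμ1 hβ₁.le
  set A := C₂ * (1 + μ / (δ / (2 * β₂))) with hA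
  set B := C₀ + C₁ * (1 + β₁ / δ) with hB
  have hA0 : 0 ≤ A := by positivity
  have hB0 : 0 ≤ B := by positivity
  refine ⟨A + B + (C₀ + C₁) + β₁ * C₀ + 1, by positivity, fun d hd P hP => ?_⟩
  have hd1 : (1 : ℝ) ≤ d := by exact_mod_cast hd
  have hd0 : (0 : ℝ) < d := by linarith
  have hP0 : 0 < P := by linarith
  have hP1 : 1 ≤ P := by linarith
  have hlogd : 0 ≤ Real.log d := Real.log_nonneg hd1
  have hlogP : 0 ≤ Real.log P := Real.log_nonneg hP1
  set w := (d : ℝ) ^ υ with hw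
  have hw0 : 0 < w := by positivity
  have hww : w ≤ (d : ℝ) ^ (υ + δ) := Real.rpow_le_rpow_of_exponent_le hd1 (by linarith)
  suffices hmain : |(∑' kl : ℕ × ℕ,
          if 1 ≤ kl.1 ∧ (kl.1 : ℝ) ≤ (d : ℝ)⁻¹ * P ^ μ ∧
              P ^ (1/2 : ℝ) < (kl.2 : ℝ) ^ β₂ ∧ (kl.2 : ℝ) ^ β₂ ≤ P / (kl.1 : ℝ) ^ β₁ then
            f d kl.1 kl.2 else 0) - β₁ * μ * C d * P * Real.log P| ≤
      (A + B + (C₀ + C₁) + β₁ * C₀ * Real.log d) * (w * P) by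
    refine hmain.trans ?_
    calc _ ≤ ((A + B + (C₀ + C₁) + β₁ * C₀ + 1) * (1 + Real.log d)) * (w * P) := by
          gcongr
          have : 0 ≤ (A + B + (C₀ + C₁)) * Real.log d := by positivity
          nlinarith [mul_nonneg hβ₁.le hC₀]
      _ = (A + B + (C₀ + C₁) + β₁ * C₀ + 1) * w * (1 + Real.log d) * P := by ring
      _ ≤ _ := by gcongr
  set K := (d : ℝ)⁻¹ * P ^ μ with hKdef
  have hK0 : 0 < K := by positivity
  have hKP : K ≤ P ^ μ := by
    rw [hKdef, inv_mul_eq_div]; exact div_le_self (by positivity) hd1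
  have hKβ : P ^ (1/2 : ℝ) * K ^ β₁ ≤ P := by
    calc P ^ (1/2 : ℝ) * K ^ β₁ ≤ P ^ (1/2 : ℝ) * (P ^ μ) ^ β₁ := by gcongr
      _ = P ^ (1 / 2 + μ * β₁) := by rw [← Real.rpow_mul hP0.le, ← Real.rpow_add hP0]
      _ ≤ P ^ (1 : ℝ) := Real.rpow_le_rpow_of_exponent_le hP1 (by linarith)
      _ = P := Real.rpow_one P
  have hlogK : Real.log K = μ * Real.log P - Real.log d := by
    rw [hKdef, Real.log_mul (by positivity) (by positivity), Real.log_inv, Real.log_rpow hP0]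
    ring
  have hCd := hC d hd
  rw [tsum_ite_eq_sum_sub_boxSum hβ₁ hβ₂ hP0 (by positivity) hK0.le hKβ]
  rcases lt_or_ge K 1 with hK | hK
  · have hKneg : μ * Real.log P ≤ Real.log d := by
      have := Real.log_nonpos hK0.le hK.le
      linarith
    have hfl : ⌊K⌋₊ = 0 := Nat.floor_eq_zero.mpr hK
    rw [boxSum, hfl]
    have hnn : 0 ≤ β₁ * μ * C d * P * Real.log P := by have := hC0 d; positivity
    simp only [Finset.Icc_eq_empty_of_lt zero_lt_one, Finset.sum_empty, sub_zero, zero_sub, abs_neg]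
    rw [abs_of_nonneg hnn]
    calc β₁ * μ * C d * P * Real.log P = β₁ * P * (C d * (μ * Real.log P)) := by ring
      _ ≤ β₁ * P * (C₀ * w * Real.log d) := by
          gcongr
      _ = (β₁ * C₀ * Real.log d) * (w * P) := by ring
      _ ≤ _ := by
          gcongr
          have : 0 ≤ A + B + (C₀ + C₁) := by positivity
          linarith
  · have hrows := abs_sum_sub_main_le hβ₁ hβ₂ hα hδ hC₂ hII hμ hμ1' hμ2 hμ3 hd hP hK
    have habel := abs_sum_mul_rpow_neg_sub_log_le hβ₁ hδ (E := C₁ * w) (by positivity) (c₁ d)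
      (fun K hK => abs_sum_coeff_sub_le hα hδ hI hII₁ hd hK) hK
    rw [abs_of_nonneg (hC0 d)] at habel
    have hQ1 : 1 ≤ (P ^ (1/2 : ℝ)) ^ β₂⁻¹ :=
      Real.one_le_rpow (Real.one_le_rpow hP1 (by norm_num)) (by positivity)
    have hbox : |boxSum f d K ((P ^ (1/2 : ℝ)) ^ β₂⁻¹)| ≤ (C₀ + C₁) * (w * P) := by
      have h := hI d hd K _ hK hQ1
      rw [Real.rpow_inv_rpow (by positivity) hβ₂.ne'] at h
      have hmin : (min K ((P ^ (1/2 : ℝ)) ^ β₂⁻¹)) ^ (-δ) ≤ 1 :=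
        Real.rpow_le_one_of_one_le_of_nonpos (le_min hK hQ1) (by linarith)
      have h1 : C₁ * w * K ^ β₁ * P ^ (1/2 : ℝ) * (min K ((P ^ (1/2 : ℝ)) ^ β₂⁻¹)) ^ (-δ) ≤
          C₁ * (w * P) := by
        calc _ ≤ C₁ * w * K ^ β₁ * P ^ (1/2 : ℝ) * 1 := by gcongr
          _ = C₁ * w * (P ^ (1/2 : ℝ) * K ^ β₁) := by ring
          _ ≤ C₁ * w * P := by gcongr
          _ = _ := by ring
      have h2 : C d * K ^ β₁ * P ^ (1/2 : ℝ) ≤ C₀ * (w * P) := by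
        calc _ = C d * (P ^ (1/2 : ℝ) * K ^ β₁) := by ring
          _ ≤ C₀ * w * P := by gcongr
          _ = _ := by ring
      have h3 : 0 ≤ C d * K ^ β₁ * P ^ (1/2 : ℝ) := by have := hC0 d; positivity
      have h4 := h.trans h1
      rw [abs_le] at h4 ⊢
      constructor <;> linarith [h4.1, h4.2, mul_nonneg hC₁ (mul_pos hw0 hP0).le]
    have habel' : |P * ∑ k ∈ Finset.Icc 1 ⌊K⌋₊, (k : ℝ) ^ (-β₁) * c₁ d k -
        P * (β₁ * C d * Real.log K)| ≤ B * (w * P) := by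
      rw [← mul_sub, abs_mul, abs_of_pos hP0]
      calc _ ≤ P * (C₀ * w + C₁ * w * (1 + β₁ / δ)) := by
            gcongr
            exact habel.trans (by gcongr)
        _ = B * (w * P) := by rw [hB]; ring
    have hlogs : P * (β₁ * C d * Real.log K) =
        β₁ * μ * C d * P * Real.log P - C d * (β₁ * P * Real.log d) := by rw [hlogK]; ring
    have hlow : C d * (β₁ * P * Real.log d) ≤ C₀ * w * (β₁ * P * Real.log d) := by gcongr
    have hlow0 : 0 ≤ C d * (β₁ * P * Real.log d) := by have := hC0 d; positivity
    rw [hlogs] at habel'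
    rw [← hKdef, ← hA, ← hw] at hrows
    rw [abs_le] at hrows hbox habel' ⊢
    constructor <;> linarith [hrows.1, hrows.2, hbox.1, hbox.2, habel'.1, habel'.2]
end
end

section
/- Let (f_d)_{d≥1} be a (β₁,β₂,C_d,D,α,υ,δ)-family of functions with C_d = O(d^υ), and let μ be a real number with 0 < μ < min{1/(2β₁), 1/(2β₂)} satisfying 0 < β₁μ < 1/2, μ·(1 + αβ₁/β₂) ≤ α/β₂, and μ·(D − β₁ + 1 + δβ₁/β₂) < δ/(2β₂). Then, uniformly for all integers d ≥ 1 and all P ≥ 2: T_{d,2} := ∑_{k : d^{−1}·P^{μ} < k ≤ P^{1/(2β₁)}} ∑_{l : P^{1/2} < l^{β₂} ≤ P/k^{β₁}} f_d(k,l) = (1/2 − β₁μ)·C_d·P·log P + O(d^{υ+δ}·(1 + log d)·P). -/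
open scoped BigOperators

noncomputable section

/-- The `l`-coordinate of the point on the curve `k ^ β₁ * l ^ β₂ = P` with `k = t`. -/
def hyperbolaEdge (β₁ β₂ P t : ℝ) : ℝ := (P / t ^ β₁) ^ (1 / β₂)

/-- The sum of `g k l` over `A < k ≤ B` and `1 ≤ l`, `k ^ β₁ * l ^ β₂ ≤ P`. -/
def hyperbolaSum (β₁ β₂ P : ℝ) (g : ℕ → ℕ → ℝ) (A B : ℝ) : ℝ :=
  ∑ k ∈ Finset.Ioc ⌊A⌋₊ ⌊B⌋₊, ∑ l ∈ Finset.Icc 1 ⌊hyperbolaEdge β₁ β₂ P k⌋₊, g k l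

lemma hyperbolaEdge_nonneg {β₁ β₂ P t : ℝ} (hP : 0 ≤ P) (ht : 0 ≤ t) :
    0 ≤ hyperbolaEdge β₁ β₂ P t := by
  unfold hyperbolaEdge; positivity

lemma hyperbolaEdge_rpow {β₁ β₂ P t : ℝ} (hβ₂ : 0 < β₂) (hP : 0 ≤ P) (ht : 0 ≤ t) :
    hyperbolaEdge β₁ β₂ P t ^ β₂ = P / t ^ β₁ := by
  unfold hyperbolaEdge
  rw [← Real.rpow_mul (by positivity), one_div_mul_cancel hβ₂.ne', Real.rpow_one]

lemma hyperbolaEdge_anti {β₁ β₂ P s t : ℝ} (hβ₁ : 0 < β₁) (hβ₂ : 0 < β₂) (hP : 0 ≤ P)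
    (hs : 0 < s) (hst : s ≤ t) :
    hyperbolaEdge β₁ β₂ P t ≤ hyperbolaEdge β₁ β₂ P s := by
  unfold hyperbolaEdge
  have : 0 < t := hs.trans_le hst
  gcongr

lemma sum_Ioc_eq_boxSum_sub (f : ℕ → ℕ → ℕ → ℝ) (d : ℕ) {A B : ℝ} (L : ℝ) (hAB : A ≤ B) :
    ∑ k ∈ Finset.Ioc ⌊A⌋₊ ⌊B⌋₊, ∑ l ∈ Finset.Icc 1 ⌊L⌋₊, f d k l =
      boxSum f d B L - boxSum f d A L := by
  have h := Finset.sum_Ioc_consecutive (fun k => ∑ l ∈ Finset.Icc 1 ⌊L⌋₊, f d k l)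
    (Nat.zero_le ⌊A⌋₊) (Nat.floor_le_floor hAB)
  simp only [boxSum, ← Finset.Icc_add_one_left_eq_Ioc 0, zero_add] at h ⊢
  linarith

lemma boxSum_nonneg {f : ℕ → ℕ → ℕ → ℝ} (hf0 : ∀ d k l, 0 ≤ f d k l) (d : ℕ) (K L : ℝ) :
    0 ≤ boxSum f d K L :=
  Finset.sum_nonneg fun _ _ => Finset.sum_nonneg fun _ _ => hf0 _ _ _

lemma hyperbolaSum_le_boxSum_sub {β₁ β₂ P A B : ℝ} {f : ℕ → ℕ → ℕ → ℝ}
    (hf0 : ∀ d k l, 0 ≤ f d k l) (d : ℕ) (hβ₁ : 0 < β₁) (hβ₂ : 0 < β₂) (hP : 0 ≤ P)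
    (hA : 0 < A) (hAB : A ≤ B) :
    hyperbolaSum β₁ β₂ P (f d) A B ≤
      boxSum f d B (hyperbolaEdge β₁ β₂ P A) - boxSum f d A (hyperbolaEdge β₁ β₂ P A) := by
  rw [← sum_Ioc_eq_boxSum_sub f d _ hAB]
  refine Finset.sum_le_sum fun k hk => Finset.sum_le_sum_of_subset_of_nonneg ?_
    fun _ _ _ => hf0 _ _ _
  have hAk : A < k := Nat.lt_of_floor_lt (Finset.mem_Ioc.1 hk).1
  exact Finset.Icc_subset_Icc_right
    (Nat.floor_le_floor (hyperbolaEdge_anti hβ₁ hβ₂ hP hA hAk.le))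

lemma boxSum_sub_le_hyperbolaSum {β₁ β₂ P A B : ℝ} {f : ℕ → ℕ → ℕ → ℝ}
    (hf0 : ∀ d k l, 0 ≤ f d k l) (d : ℕ) (hβ₁ : 0 < β₁) (hβ₂ : 0 < β₂) (hP : 0 ≤ P)
    (hA : 0 < A) (hAB : A ≤ B) :
    boxSum f d B (hyperbolaEdge β₁ β₂ P B) - boxSum f d A (hyperbolaEdge β₁ β₂ P B) ≤
      hyperbolaSum β₁ β₂ P (f d) A B := by
  rw [← sum_Ioc_eq_boxSum_sub f d _ hAB]
  refine Finset.sum_le_sum fun k hk => Finset.sum_le_sum_of_subset_of_nonneg ?_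
    fun _ _ _ => hf0 _ _ _
  have hAk : A < k := Nat.lt_of_floor_lt (Finset.mem_Ioc.1 hk).1
  have hkB : (k : ℝ) ≤ B := (Nat.le_floor_iff (hA.le.trans hAB)).1 (Finset.mem_Ioc.1 hk).2
  exact Finset.Icc_subset_Icc_right
    (Nat.floor_le_floor (hyperbolaEdge_anti hβ₁ hβ₂ hP (hA.trans hAk) hkB))

lemma hyperbolaSum_eq_sum_range (β₁ β₂ P : ℝ) (g : ℕ → ℕ → ℝ) {a : ℕ → ℝ} (ha : Monotone a)
    (N : ℕ) :
    hyperbolaSum β₁ β₂ P g (a 0) (a N) =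
      ∑ i ∈ Finset.range N, hyperbolaSum β₁ β₂ P g (a i) (a (i + 1)) := by
  induction N with
  | zero => simp [hyperbolaSum]
  | succ n ih =>
    rw [Finset.sum_range_succ, ← ih]
    exact (Finset.sum_Ioc_consecutive _ (Nat.floor_le_floor (ha n.zero_le))
      (Nat.floor_le_floor (ha n.le_succ))).symm

/-- On a short range `A < k ≤ A * exp (y / β₁)` the sum under the hyperbola is `C * P * y`, up to
second order in `y` and the errors of the box sums. -/
lemma abs_hyperbolaSum_sub_le_of_short {β₁ β₂ P A B y C E : ℝ} {f : ℕ → ℕ → ℕ → ℝ}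
    (hf0 : ∀ d k l, 0 ≤ f d k l) (d : ℕ) (hβ₁ : 0 < β₁) (hβ₂ : 0 < β₂) (hP : 0 < P)
    (hC : 0 ≤ C) (hA : 0 < A) (hy0 : 0 ≤ y) (hy1 : y ≤ 1) (hB : B = A * Real.exp (y / β₁))
    (hE : ∀ K L : ℝ, A ≤ K → hyperbolaEdge β₁ β₂ P B ≤ L →
      K ^ β₁ * L ^ β₂ ≤ Real.exp 1 * P → |boxSum f d K L - C * K ^ β₁ * L ^ β₂| ≤ E) :
    |hyperbolaSum β₁ β₂ P (f d) A B - C * P * y| ≤ C * P * y ^ 2 + 2 * E := by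
  have hAB : A ≤ B := by
    rw [hB]; exact le_mul_of_one_le_right hA.le (Real.one_le_exp (by positivity))
  have hB0 : 0 < B := hA.trans_le hAB
  have hBA : B ^ β₁ = A ^ β₁ * Real.exp y := by
    rw [hB, Real.mul_rpow hA.le (Real.exp_pos _).le, ← Real.exp_mul, div_mul_cancel₀ _ hβ₁.ne']
  have hanti := hyperbolaEdge_anti hβ₁ hβ₂ hP.le hA hAB
  have hAp : 0 < A ^ β₁ := by positivity
  have hA1 : A ^ β₁ * hyperbolaEdge β₁ β₂ P A ^ β₂ = P := by
    rw [hyperbolaEdge_rpow hβ₂ hP.le hA.le]; field_simp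
  have hA2 : B ^ β₁ * hyperbolaEdge β₁ β₂ P A ^ β₂ = Real.exp y * P := by
    rw [hyperbolaEdge_rpow hβ₂ hP.le hA.le, hBA]; field_simp
  have hB1 : B ^ β₁ * hyperbolaEdge β₁ β₂ P B ^ β₂ = P := by
    rw [hyperbolaEdge_rpow hβ₂ hP.le hB0.le]
    have : 0 < B ^ β₁ := by positivity
    field_simp
  have hB2 : A ^ β₁ * hyperbolaEdge β₁ β₂ P B ^ β₂ = Real.exp (-y) * P := by
    rw [hyperbolaEdge_rpow hβ₂ hP.le hB0.le, hBA, Real.exp_neg]; field_simp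
  have hP1 : P ≤ Real.exp 1 * P :=
    le_mul_of_one_le_left hP.le (Real.one_le_exp zero_le_one)
  have e1 := hE A _ le_rfl hanti (by rw [hA1]; exact hP1)
  have e2 := hE B _ hAB hanti (by rw [hA2]; gcongr)
  have e3 := hE B _ hAB le_rfl (by rw [hB1]; exact hP1)
  have e4 := hE A _ le_rfl le_rfl (by rw [hB2]; gcongr; linarith)
  rw [mul_assoc C] at e1 e2 e3 e4
  rw [hA1] at e1
  rw [hA2] at e2
  rw [hB1] at e3
  rw [hB2] at e4
  have u := hyperbolaSum_le_boxSum_sub hf0 d hβ₁ hβ₂ hP.le hA hAB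
  have l := boxSum_sub_le_hyperbolaSum hf0 d hβ₁ hβ₂ hP.le hA hAB
  have x1 := Real.abs_exp_sub_one_sub_id_le (x := y) (by rwa [abs_of_nonneg hy0])
  have x2 := Real.abs_exp_sub_one_sub_id_le (x := -y) (by rwa [abs_neg, abs_of_nonneg hy0])
  rw [abs_le] at *
  have hCP : 0 ≤ C * P := by positivity
  have m1 := mul_le_mul_of_nonneg_left x1.2 hCP
  have m2 := mul_le_mul_of_nonneg_left x2.2 hCP
  constructor <;> nlinarith

lemma abs_hyperbolaSum_sub_le {β₁ β₂ P A B y C E : ℝ} {f : ℕ → ℕ → ℕ → ℝ}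
    (hf0 : ∀ d k l, 0 ≤ f d k l) (d : ℕ) (hβ₁ : 0 < β₁) (hβ₂ : 0 < β₂) (hP : 0 < P)
    (hC : 0 ≤ C) (hA : 0 < A) (hy0 : 0 ≤ y) (hy1 : y ≤ 1) (N : ℕ)
    (hB : B = A * Real.exp (N * y / β₁))
    (hE : ∀ K L : ℝ, A ≤ K → hyperbolaEdge β₁ β₂ P B ≤ L →
      K ^ β₁ * L ^ β₂ ≤ Real.exp 1 * P → |boxSum f d K L - C * K ^ β₁ * L ^ β₂| ≤ E) :
    |hyperbolaSum β₁ β₂ P (f d) A B - C * P * (N * y)| ≤ N * (C * P * y ^ 2 + 2 * E) := by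
  set a : ℕ → ℝ := fun i => A * Real.exp (i * y / β₁) with ha
  have hmono : Monotone a := fun i j hij => by simp only [ha]; gcongr
  have ha0 : a 0 = A := by simp [ha]
  have haN : a N = B := hB.symm
  have hpos : ∀ i, 0 < a i := fun i => by simp only [ha]; positivity
  rw [← ha0, ← haN, hyperbolaSum_eq_sum_range _ _ _ _ hmono]
  have hconst : C * P * (N * y) = ∑ i ∈ Finset.range N, C * P * y := by
    rw [Finset.sum_const, Finset.card_range, nsmul_eq_mul]; ring
  rw [hconst, ← Finset.sum_sub_distrib]
  refine (Finset.abs_sum_le_sum_abs _ _).trans ?_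
  refine (Finset.sum_le_card_nsmul _ _ (C * P * y ^ 2 + 2 * E) fun i hi => ?_).trans
    (by rw [Finset.card_range, nsmul_eq_mul])
  refine abs_hyperbolaSum_sub_le_of_short hf0 d hβ₁ hβ₂ hP hC (hpos i) hy0 hy1 ?_ ?_
  · simp only [ha]
    rw [mul_assoc, ← Real.exp_add]
    push_cast
    ring_nf
  · intro K L hK hL hKL
    refine hE K L (le_trans ?_ hK) (le_trans ?_ hL) hKL
    · rw [← ha0]; exact hmono i.zero_le
    · rw [← haN]
      exact hyperbolaEdge_anti hβ₁ hβ₂ hP.le (hpos _) (hmono (Finset.mem_range.1 hi))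

/-- The sum over the region `A < k ≤ B`, `Q < l ^ β₂ ≤ P / k ^ β₁`, as a difference of the sum
under the hyperbola and box sums. -/
lemma tsum_eq_hyperbolaSum_sub {β₁ β₂ P A B Q : ℝ} (f : ℕ → ℕ → ℕ → ℝ) (d : ℕ) (hβ₁ : 0 < β₁)
    (hβ₂ : 0 < β₂) (hP : 0 ≤ P) (hA : 0 ≤ A) (hAB : A ≤ B) (hQ : 0 ≤ Q)
    (hQB : B ^ β₁ * Q ≤ P) :
    (∑' kl : ℕ × ℕ, if A < (kl.1 : ℝ) ∧ (kl.1 : ℝ) ≤ B ∧ Q < (kl.2 : ℝ) ^ β₂ ∧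
        (kl.2 : ℝ) ^ β₂ ≤ P / (kl.1 : ℝ) ^ β₁ then f d kl.1 kl.2 else 0) =
      hyperbolaSum β₁ β₂ P (f d) A B -
        (boxSum f d B (Q ^ (1 / β₂)) - boxSum f d A (Q ^ (1 / β₂))) := by
  have hB : 0 ≤ B := hA.trans hAB
  have hlow : ∀ l : ℕ, Q < (l : ℝ) ^ β₂ ↔ ⌊Q ^ (1 / β₂)⌋₊ < l := fun l => by
    rw [Nat.floor_lt (by positivity), one_div, Real.rpow_inv_lt_iff_of_pos hQ (by positivity) hβ₂]
  have hupp : ∀ k l : ℕ, (l : ℝ) ^ β₂ ≤ P / (k : ℝ) ^ β₁ ↔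
      l ≤ ⌊hyperbolaEdge β₁ β₂ P k⌋₊ := fun k l => by
    rw [Nat.le_floor_iff (hyperbolaEdge_nonneg hP (by positivity)), hyperbolaEdge, one_div,
      Real.le_rpow_inv_iff_of_pos (by positivity) (by positivity) hβ₂]
  have hk1 : ∀ k : ℕ, A < k → ⌊hyperbolaEdge β₁ β₂ P k⌋₊ ≤ ⌊hyperbolaEdge β₁ β₂ P 1⌋₊ :=
    fun k hk => by
      have : 0 < k := by exact_mod_cast hA.trans_lt hk
      exact Nat.floor_le_floor
        (hyperbolaEdge_anti hβ₁ hβ₂ hP one_pos (by exact_mod_cast this))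
  rw [tsum_eq_sum (s := Finset.Ioc ⌊A⌋₊ ⌊B⌋₊ ×ˢ
    Finset.Icc 1 ⌊hyperbolaEdge β₁ β₂ P 1⌋₊)]
  · rw [Finset.sum_product, ← sum_Ioc_eq_boxSum_sub f d _ hAB, hyperbolaSum,
      ← Finset.sum_sub_distrib]
    refine Finset.sum_congr rfl fun k hk => ?_
    have hAk : A < k := (Nat.floor_lt hA).1 (Finset.mem_Ioc.1 hk).1
    have hkB : (k : ℝ) ≤ B := (Nat.le_floor_iff hB).1 (Finset.mem_Ioc.1 hk).2
    have hk0 : (0 : ℝ) < k := hA.trans_lt hAk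
    have hle : ⌊Q ^ (1 / β₂)⌋₊ ≤ ⌊hyperbolaEdge β₁ β₂ P k⌋₊ := by
      refine Nat.floor_le_floor (Real.rpow_le_rpow hQ ?_ (by positivity))
      rw [le_div_iff₀ (by positivity), mul_comm]
      refine le_trans ?_ hQB
      gcongr
    have hsplit := Finset.sum_Ioc_consecutive (fun l => f d k l)
      (Nat.zero_le ⌊Q ^ (1 / β₂)⌋₊) hle
    simp only [← Finset.Icc_add_one_left_eq_Ioc 0, zero_add] at hsplit
    rw [← hsplit, add_sub_cancel_left, ← Finset.sum_filter]
    refine Finset.sum_congr ?_ fun _ _ => rfl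
    ext l
    have := hk1 k hAk
    simp only [Finset.mem_filter, Finset.mem_Icc, Finset.mem_Ioc, hlow, hupp, hAk, hkB, true_and]
    omega
  · rintro ⟨k, l⟩ hkl
    refine if_neg fun ⟨h1, h2, h3, h4⟩ => hkl ?_
    simp only at h1 h2 h3 h4
    rw [hlow] at h3
    rw [hupp] at h4
    have := hk1 k h1
    simp only [Finset.mem_product, Finset.mem_Ioc, Finset.mem_Icc]
    exact ⟨⟨(Nat.floor_lt hA).2 h1, (Nat.le_floor_iff hB).2 h2⟩, by omega, by omega⟩

lemma log_sq_mul_rpow_neg_le {P ε : ℝ} (hP : 1 ≤ P) (hε : 0 < ε) :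
    (2 * Real.log P ^ 2 + 6) * P ^ (-ε) ≤ 8 / ε ^ 2 + 6 := by
  have hlog : 0 ≤ Real.log P := Real.log_nonneg hP
  have h := Real.log_le_rpow_div (zero_le_one.trans hP) (half_pos hε)
  have h2 : Real.log P ^ 2 ≤ 4 / ε ^ 2 * P ^ ε := by
    calc Real.log P ^ 2 ≤ (P ^ (ε / 2) / (ε / 2)) ^ 2 := by gcongr
      _ = 4 / ε ^ 2 * (P ^ (ε / 2) * P ^ (ε / 2)) := by ring
      _ = 4 / ε ^ 2 * P ^ ε := by rw [← Real.rpow_add (by linarith), add_halves]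
  have h3 : P ^ ε * P ^ (-ε) = 1 := by
    rw [← Real.rpow_add (by linarith), add_neg_cancel, Real.rpow_zero]
  have h4 : P ^ (-ε) ≤ 1 := Real.rpow_le_one_of_one_le_of_nonpos hP (by linarith)
  have h5 : 0 < P ^ (-ε) := by positivity
  have h6 := mul_le_mul_of_nonneg_right h2 h5.le
  rw [mul_assoc, h3] at h6
  have : 8 / ε ^ 2 = 2 * (4 / ε ^ 2) := by ring
  nlinarith

lemma abs_boxSum_sub_le {β₁ β₂ υ δ C₁ c K L m P : ℝ} {f : ℕ → ℕ → ℕ → ℝ} {d : ℕ} (hδ : 0 < δ)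
    (hC₁ : 0 ≤ C₁)
    (hbox : ∀ K L : ℝ, 1 ≤ K → 1 ≤ L → |boxSum f d K L - c * K ^ β₁ * L ^ β₂| ≤
      C₁ * (d : ℝ) ^ υ * K ^ β₁ * L ^ β₂ * (min K L) ^ (-δ))
    (hm : 1 ≤ m) (hK : m ≤ K) (hL : m ≤ L) (hKL : K ^ β₁ * L ^ β₂ ≤ P) :
    |boxSum f d K L - c * K ^ β₁ * L ^ β₂| ≤ C₁ * (d : ℝ) ^ υ * P * m ^ (-δ) := by
  have hK0 : 0 < K := by linarith
  have hL0 : 0 < L := by linarith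
  refine (hbox K L (hm.trans hK) (hm.trans hL)).trans ?_
  rw [mul_assoc (C₁ * (d : ℝ) ^ υ)]
  have h1 : (min K L) ^ (-δ) ≤ m ^ (-δ) :=
    Real.rpow_le_rpow_of_nonpos (by linarith) (le_min hK hL) (by linarith)
  have h2 : 0 < K ^ β₁ * L ^ β₂ := by positivity
  have h3 : 0 ≤ P := h2.le.trans hKL
  gcongr

set_option maxHeartbeats 400000 in
lemma abs_hyperbolaSum_truncated_sub_le {β₁ β₂ υ δ μ C₀ C₁ c P : ℝ} {f : ℕ → ℕ → ℕ → ℝ}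
    (hf0 : ∀ d k l, 0 ≤ f d k l) {d : ℕ} (hd : 1 ≤ d) (hβ₁ : 0 < β₁) (hβ₂ : 0 < β₂) (hδ : 0 < δ)
    (hμ0 : 0 < μ) (hμ1 : μ < 1 / (2 * β₁)) (hμ2 : μ < 1 / (2 * β₂)) (hC₀ : 0 ≤ C₀)
    (hC₁ : 0 ≤ C₁) (hc0 : 0 ≤ c) (hc : c ≤ C₀ * (d : ℝ) ^ υ)
    (hbox : ∀ K L : ℝ, 1 ≤ K → 1 ≤ L → |boxSum f d K L - c * K ^ β₁ * L ^ β₂| ≤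
      C₁ * (d : ℝ) ^ υ * K ^ β₁ * L ^ β₂ * (min K L) ^ (-δ))
    (hP : 1 ≤ P) (hdP : (d : ℝ) ≤ P ^ μ) :
    |hyperbolaSum β₁ β₂ P (f d) ((d : ℝ)⁻¹ * P ^ μ) (P ^ (1 / (2 * β₁))) -
        (boxSum f d (P ^ (1 / (2 * β₁))) ((P ^ (1 / 2 : ℝ)) ^ (1 / β₂)) -
          boxSum f d ((d : ℝ)⁻¹ * P ^ μ) ((P ^ (1 / 2 : ℝ)) ^ (1 / β₂))) -
        (1 / 2 - β₁ * μ) * c * P * Real.log P| ≤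
      (C₀ * (3 + β₁) + C₁ * Real.exp 1 * (8 / (μ * δ) ^ 2 + 6)) * (d : ℝ) ^ (υ + δ) *
        (1 + Real.log d) * P := by
  have hd1 : (1 : ℝ) ≤ d := by exact_mod_cast hd
  have hd0 : (0 : ℝ) < d := by linarith
  have hP0 : 0 < P := by linarith
  set u := Real.log P with hu
  have hu0 : 0 ≤ u := Real.log_nonneg hP
  have hld : 0 ≤ Real.log d := Real.log_nonneg hd1
  have hldu : Real.log d ≤ μ * u := by
    rw [hu, ← Real.log_rpow hP0]; exact Real.log_le_log hd0 hdP
  have hβμ : β₁ * μ < 1 / 2 := by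
    rw [lt_div_iff₀ (by positivity)] at hμ1; linarith
  set A := (d : ℝ)⁻¹ * P ^ μ with hA
  set B := P ^ (1 / (2 * β₁)) with hB
  set L₀ := (P ^ (1 / 2 : ℝ)) ^ (1 / β₂) with hL₀
  have hA1 : 1 ≤ A := by rw [hA, inv_mul_eq_div, le_div_iff₀ hd0]; linarith
  have hA0 : 0 < A := by linarith
  have hAP : A ≤ P ^ μ := by
    rw [hA, inv_mul_eq_div]; exact div_le_self (by positivity) hd1
  have hAB : A ≤ B := hAP.trans (Real.rpow_le_rpow_of_exponent_le hP hμ1.le)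
  have hAL : A ≤ L₀ := by
    refine hAP.trans ?_
    rw [hL₀, ← Real.rpow_mul hP0.le]
    refine Real.rpow_le_rpow_of_exponent_le hP (hμ2.le.trans_eq ?_)
    field_simp
  have hB0 : 0 < B := by positivity
  have hL0 : 0 < L₀ := by positivity
  have hBβ : B ^ β₁ = P ^ (1 / 2 : ℝ) := by
    rw [hB, ← Real.rpow_mul hP0.le]; congr 1; field_simp
  have hPP : P ^ (1 / 2 : ℝ) * P ^ (1 / 2 : ℝ) = P := by
    rw [← Real.rpow_add hP0, add_halves, Real.rpow_one]
  have hLβ : L₀ ^ β₂ = P ^ (1 / 2 : ℝ) := by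
    rw [hL₀, ← Real.rpow_mul (by positivity), one_div_mul_cancel hβ₂.ne', Real.rpow_one]
  have hedge : hyperbolaEdge β₁ β₂ P B = L₀ := by
    rw [hyperbolaEdge, hBβ, hL₀]
    congr 1
    rw [div_eq_iff (by positivity), hPP]
  set E := C₁ * (d : ℝ) ^ υ * (Real.exp 1 * P) * A ^ (-δ) with hE
  have hbd : ∀ K L : ℝ, A ≤ K → L₀ ≤ L → K ^ β₁ * L ^ β₂ ≤ Real.exp 1 * P →
      |boxSum f d K L - c * K ^ β₁ * L ^ β₂| ≤ E := fun K L hK hL hKL =>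
    abs_boxSum_sub_le hδ hC₁ hbox hA1 hK (hAL.trans hL) hKL
  have hP1 : P ≤ Real.exp 1 * P :=
    le_mul_of_one_le_left hP0.le (Real.one_le_exp zero_le_one)
  have hBL : B ^ β₁ * L₀ ^ β₂ = P := by rw [hBβ, hLβ, hPP]
  have hABL : A ^ β₁ * L₀ ^ β₂ ≤ P := by rw [← hBL]; gcongr
  have b1 := hbd B L₀ hAB le_rfl (hBL.trans_le hP1)
  have b2 := hbd A L₀ le_rfl le_rfl (hABL.trans hP1)
  have n1 := boxSum_nonneg hf0 d B L₀
  have n2 := boxSum_nonneg hf0 d A L₀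
  rw [mul_assoc c] at b1 b2
  rw [hBL] at b1
  have hcA : c * (A ^ β₁ * L₀ ^ β₂) ≤ c * P := by gcongr
  set Λ := (1 / 2 - β₁ * μ) * u + β₁ * Real.log d with hΛ
  have hΛ0 : 0 ≤ Λ := by
    have : 0 ≤ (1 / 2 - β₁ * μ) * u := mul_nonneg (by linarith) hu0
    positivity
  have hΛu : Λ ≤ u := by
    have := mul_le_mul_of_nonneg_left hldu hβ₁.le
    rw [hΛ]
    linarith
  have hΛu2 : Λ ^ 2 ≤ u ^ 2 := pow_le_pow_left₀ hΛ0 hΛu 2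
  have hu2 : u ≤ u ^ 2 + 1 := by linarith [sq_nonneg (u - 1), sq_nonneg u]
  set N := ⌈u ^ 2 + 1⌉₊ with hN
  have hN1 : u ^ 2 + 1 ≤ N := Nat.le_ceil _
  have hN2 : (N : ℝ) ≤ u ^ 2 + 2 := by
    have := (Nat.ceil_lt_add_one (show 0 ≤ u ^ 2 + 1 by positivity)).le
    linarith
  have hN0 : (0 : ℝ) < N := by linarith [sq_nonneg u]
  have hNy : N * (Λ / N) = Λ := by field_simp
  have hBA : B = A * Real.exp (N * (Λ / N) / β₁) := by
    have e1 : Λ / β₁ = 1 / (2 * β₁) * u - μ * u + Real.log d := by rw [hΛ]; field_simp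
    rw [hNy, e1, Real.exp_add, Real.exp_sub, Real.exp_log hd0, hA, hB,
      Real.rpow_def_of_pos hP0, Real.rpow_def_of_pos hP0, ← hu, mul_comm u, mul_comm u]
    field_simp
  have hmain := abs_hyperbolaSum_sub_le hf0 d hβ₁ hβ₂ hP0 hc0 hA0 (y := Λ / N) (by positivity)
    (by rw [div_le_one hN0]; linarith) N hBA (by rw [hedge]; exact hbd)
  rw [hNy] at hmain
  have hsq : N * (c * P * (Λ / N) ^ 2) ≤ c * P := by
    have : N * (c * P * (Λ / N) ^ 2) = c * P * (Λ ^ 2 / N) := by field_simp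
    rw [this]
    refine mul_le_of_le_one_right (by positivity) ?_
    rw [div_le_one hN0]
    linarith
  have hE0 : 0 ≤ E := by positivity
  have hNE : (2 * N + 2) * E ≤
      C₁ * Real.exp 1 * (8 / (μ * δ) ^ 2 + 6) * (d : ℝ) ^ (υ + δ) * P := by
    have hEeq : E = C₁ * Real.exp 1 * (d : ℝ) ^ (υ + δ) * P * P ^ (-(μ * δ)) := by
      rw [hE, hA, Real.mul_rpow (by positivity) (by positivity), Real.inv_rpow hd0.le,
        ← Real.rpow_neg hd0.le, neg_neg, ← Real.rpow_mul hP0.le, Real.rpow_add hd0, mul_neg]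
      ring
    calc (2 * N + 2) * E ≤ (2 * u ^ 2 + 6) * E :=
          mul_le_mul_of_nonneg_right (by linarith) hE0
      _ = C₁ * Real.exp 1 * (d : ℝ) ^ (υ + δ) * P *
          ((2 * u ^ 2 + 6) * P ^ (-(μ * δ))) := by rw [hEeq]; ring
      _ ≤ C₁ * Real.exp 1 * (d : ℝ) ^ (υ + δ) * P * (8 / (μ * δ) ^ 2 + 6) := by
          gcongr; exact log_sq_mul_rpow_neg_le hP (by positivity)
      _ = _ := by ring
  have hcd : c ≤ C₀ * (d : ℝ) ^ (υ + δ) :=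
    hc.trans (by gcongr; linarith)
  have hfin : c * P * (3 + β₁ * Real.log d) ≤
      C₀ * (3 + β₁) * (d : ℝ) ^ (υ + δ) * (1 + Real.log d) * P := by
    calc c * P * (3 + β₁ * Real.log d)
        ≤ (C₀ * (d : ℝ) ^ (υ + δ)) * P * ((3 + β₁) * (1 + Real.log d)) := by
          gcongr; linarith [mul_nonneg hβ₁.le hld]
      _ = _ := by ring
  have hfin2 : C₁ * Real.exp 1 * (8 / (μ * δ) ^ 2 + 6) * (d : ℝ) ^ (υ + δ) * P ≤
      C₁ * Real.exp 1 * (8 / (μ * δ) ^ 2 + 6) * (d : ℝ) ^ (υ + δ) * P * (1 + Real.log d) :=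
    le_mul_of_one_le_right (by positivity) (by linarith)
  have hCΛ : c * P * Λ = (1 / 2 - β₁ * μ) * c * P * u + c * P * (β₁ * Real.log d) := by
    rw [hΛ]; ring
  have hcl : 0 ≤ c * P * (β₁ * Real.log d) := by positivity
  rw [abs_le] at b1 b2 hmain ⊢
  obtain ⟨b1, b1'⟩ := b1
  obtain ⟨b2, b2'⟩ := b2
  obtain ⟨m1, m2⟩ := hmain
  constructor <;> linarith

lemma hyperbolaSum_le_of_large {β₁ β₂ υ δ μ C₀ C₁ c P A : ℝ} {f : ℕ → ℕ → ℕ → ℝ}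
    (hf0 : ∀ d k l, 0 ≤ f d k l) {d : ℕ} (hd : 1 ≤ d) (hβ₁ : 0 < β₁) (hβ₂ : 0 < β₂) (hδ : 0 < δ)
    (hμ0 : 0 < μ) (hC₀ : 0 ≤ C₀)
    (hC₁ : 0 ≤ C₁) (hc0 : 0 ≤ c) (hc : c ≤ C₀ * (d : ℝ) ^ υ)
    (hbox : ∀ K L : ℝ, 1 ≤ K → 1 ≤ L → |boxSum f d K L - c * K ^ β₁ * L ^ β₂| ≤
      C₁ * (d : ℝ) ^ υ * K ^ β₁ * L ^ β₂ * (min K L) ^ (-δ))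
    (hP : 2 ≤ P) (hdP : P ^ μ ≤ (d : ℝ)) :
    hyperbolaSum β₁ β₂ P (f d) A (P ^ (1 / (2 * β₁))) ≤
      (C₀ + C₁ * Real.exp 1) * (3 + 3 / μ) * (d : ℝ) ^ (υ + δ) * (1 + Real.log d) * P := by
  have hd1 : (1 : ℝ) ≤ d := by exact_mod_cast hd
  have hd0 : (0 : ℝ) < d := by linarith
  have hP0 : 0 < P := by linarith
  have hP1 : 1 ≤ P := by linarith
  set u := Real.log P with hu
  have hu0 : 0 < u := Real.log_pos (by linarith)
  have hld : 0 ≤ Real.log d := Real.log_nonneg hd1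
  have hldu : u ≤ Real.log d / μ := by
    rw [le_div_iff₀ hμ0, mul_comm, hu, ← Real.log_rpow hP0]
    exact Real.log_le_log (by positivity) hdP
  set B := P ^ (1 / (2 * β₁)) with hB
  have hB1 : 1 ≤ B := Real.one_le_rpow hP1 (by positivity)
  have hedge1 : 1 ≤ hyperbolaEdge β₁ β₂ P B := by
    have hBβ : B ^ β₁ = P ^ (1 / 2 : ℝ) := by
      rw [hB, ← Real.rpow_mul hP0.le]; congr 1; field_simp
    rw [hyperbolaEdge, hBβ]
    refine Real.one_le_rpow ?_ (by positivity)
    rw [one_le_div (by positivity)]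
    calc P ^ (1 / 2 : ℝ) ≤ P ^ (1 : ℝ) := by gcongr; norm_num
      _ = P := Real.rpow_one P
  have hexp1 : 1 ≤ Real.exp 1 := Real.one_le_exp zero_le_one
  set E := C₁ * (d : ℝ) ^ υ * (Real.exp 1 * P) with hE
  have hbd : ∀ K L : ℝ, 1 ≤ K → hyperbolaEdge β₁ β₂ P B ≤ L → K ^ β₁ * L ^ β₂ ≤ Real.exp 1 * P →
      |boxSum f d K L - c * K ^ β₁ * L ^ β₂| ≤ E := fun K L hK hL hKL => by
    simpa using abs_boxSum_sub_le hδ hC₁ hbox le_rfl hK (hedge1.trans hL) hKL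
  set N := ⌈u⌉₊ with hN
  have hN1 : u ≤ N := Nat.le_ceil _
  have hN2 : (N : ℝ) ≤ u + 1 := (Nat.ceil_lt_add_one hu0.le).le
  have hN0 : (0 : ℝ) < N := by linarith
  set y := u / 2 / N with hy
  have hNy : N * y = u / 2 := by rw [hy]; field_simp
  have hy0 : 0 ≤ y := by positivity
  have hy1 : y ≤ 1 := by rw [hy, div_le_one hN0]; linarith
  have hmain := abs_hyperbolaSum_sub_le hf0 d hβ₁ hβ₂ hP0 hc0 one_pos hy0 hy1 N
    (B := B) (by
      rw [hNy, one_mul, hB, Real.rpow_def_of_pos hP0, ← hu]; congr 1; field_simp) hbd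
  have hone : (1 : ℝ) ^ β₁ * hyperbolaEdge β₁ β₂ P 1 ^ β₂ = P := by
    rw [hyperbolaEdge_rpow hβ₂ hP0.le zero_le_one]; simp
  have hfirst := hbd 1 _ le_rfl (hyperbolaEdge_anti hβ₁ hβ₂ hP0.le one_pos hB1)
    (hone.trans_le (le_mul_of_one_le_left hP0.le hexp1))
  rw [mul_assoc c, hone] at hfirst
  have hsplit : hyperbolaSum β₁ β₂ P (f d) A B ≤
      boxSum f d 1 (hyperbolaEdge β₁ β₂ P 1) + hyperbolaSum β₁ β₂ P (f d) 1 B := by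
    have h := Finset.sum_Ioc_consecutive
      (fun k : ℕ => ∑ l ∈ Finset.Icc 1 ⌊hyperbolaEdge β₁ β₂ P k⌋₊, f d k l)
      (Nat.zero_le 1) (Nat.one_le_floor_iff B |>.2 hB1)
    have h1 : boxSum f d 1 (hyperbolaEdge β₁ β₂ P 1) =
        ∑ k ∈ Finset.Ioc 0 1, ∑ l ∈ Finset.Icc 1 ⌊hyperbolaEdge β₁ β₂ P (k : ℕ)⌋₊, f d k l := by
      simp [boxSum]
    rw [h1, hyperbolaSum, hyperbolaSum, Nat.floor_one, h]
    exact Finset.sum_le_sum_of_subset_of_nonneg (Finset.Ioc_subset_Ioc_left (Nat.zero_le _))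
      fun _ _ _ => Finset.sum_nonneg fun _ _ => hf0 _ _ _
  rw [hNy] at hmain
  have hcP : 0 ≤ c * P := by positivity
  have hE0 : 0 ≤ E := by positivity
  have hNb : N * (c * P * y ^ 2 + 2 * E) ≤ (u + 1) * (c * P + 2 * E) := by
    have := mul_le_of_le_one_right hcP (pow_le_one₀ hy0 hy1 (n := 2))
    have h0 : 0 ≤ c * P * y ^ 2 + 2 * E := by positivity
    exact mul_le_mul hN2 (by linarith) h0 (by linarith)
  have hdd : (d : ℝ) ^ υ ≤ (d : ℝ) ^ (υ + δ) := by gcongr; linarith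
  have hsum : c * P + E ≤ (C₀ + C₁ * Real.exp 1) * (d : ℝ) ^ (υ + δ) * P := by
    calc c * P + E ≤ C₀ * (d : ℝ) ^ υ * P + C₁ * (d : ℝ) ^ υ * (Real.exp 1 * P) := by
          rw [hE]; gcongr
      _ = (C₀ + C₁ * Real.exp 1) * (d : ℝ) ^ υ * P := by ring
      _ ≤ _ := by gcongr
  have hlog : 3 + 3 * u ≤ (3 + 3 / μ) * (1 + Real.log d) := by
    have : 0 ≤ 3 / μ := by positivity
    have e : 3 / μ * Real.log d = 3 * (Real.log d / μ) := by ring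
    nlinarith
  calc hyperbolaSum β₁ β₂ P (f d) A B ≤ (c * P + E) * (3 + 3 * u) := by
        have m1 := (abs_le.1 hmain).2
        have m2 := (abs_le.1 hfirst).2
        nlinarith [mul_nonneg hcP hu0.le, mul_nonneg hE0 hu0.le]
    _ ≤ ((C₀ + C₁ * Real.exp 1) * (d : ℝ) ^ (υ + δ) * P) *
        ((3 + 3 / μ) * (1 + Real.log d)) := by gcongr
    _ = _ := by ring

/-!
Statement 18: if `(f_d)_{d ≥ 1}` is a `(β₁,β₂,C_d,D,α,υ,δ)`-family with `C_d = O(d^υ)`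
and `μ` satisfies `0 < μ < min(1/(2β₁), 1/(2β₂))`, `0 < β₁ μ < 1/2`,
`μ (1 + α β₁/β₂) ≤ α/β₂` and `μ (D - β₁ + 1 + δ β₁/β₂) < δ/(2β₂)`, then uniformly for
all `d ≥ 1` and `P ≥ 2`:
`T_{d,2} = ∑_{d⁻¹ P^μ < k ≤ P^{1/(2β₁)}} ∑_{P^{1/2} < l^{β₂} ≤ P/k^{β₁}} f_d(k,l)
        = (1/2 - β₁ μ) C_d P log P + O(d^{υ+δ} (1 + log d) P)`.
-/
theorem statement18 (β₁ β₂ α δ D υ : ℝ)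
    (hβ₁ : 0 < β₁) (hβ₂ : 0 < β₂) (hα : 0 < α) (hδ : 0 < δ) (hD : 0 ≤ D) (hυ : 0 ≤ υ)
    (f : ℕ → ℕ → ℕ → ℝ) (C : ℕ → ℝ) (c₁ c₂ : ℕ → ℕ → ℝ)
    (hf0 : ∀ d k l, 0 ≤ f d k l) (hC0 : ∀ d, 0 ≤ C d)
    (hc₁0 : ∀ d k, 0 ≤ c₁ d k) (hc₂0 : ∀ d l, 0 ≤ c₂ d l)
    (hI : FamilyCondI β₁ β₂ υ δ f C)
    (hII₁ : FamilyCondII₁ β₂ α δ D υ f c₁)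
    (hII₂ : FamilyCondII₂ β₁ α δ D υ f c₂)
    (hCd : ∃ C₀ : ℝ, ∀ d : ℕ, 1 ≤ d → C d ≤ C₀ * (d : ℝ) ^ υ)
    (μ : ℝ) (hμ0 : 0 < μ) (hμ0' : μ < min (1 / (2 * β₁)) (1 / (2 * β₂)))
    (hμ1 : 0 < β₁ * μ) (hμ1' : β₁ * μ < 1 / 2)
    (hμ2 : μ * (1 + α * β₁ / β₂) ≤ α / β₂)
    (hμ3 : μ * (D - β₁ + 1 + δ * β₁ / β₂) < δ / (2 * β₂)) :
    ∃ Cc : ℝ, 0 < Cc ∧ ∀ d : ℕ, 1 ≤ d → ∀ P : ℝ, 2 ≤ P →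
      |(∑' kl : ℕ × ℕ,
          if (d : ℝ)⁻¹ * P ^ μ < (kl.1 : ℝ) ∧ (kl.1 : ℝ) ≤ P ^ (1 / (2 * β₁)) ∧
              P ^ (1/2 : ℝ) < (kl.2 : ℝ) ^ β₂ ∧ (kl.2 : ℝ) ^ β₂ ≤ P / (kl.1 : ℝ) ^ β₁ then
            f d kl.1 kl.2 else 0) -
        (1 / 2 - β₁ * μ) * C d * P * Real.log P| ≤
      Cc * (d : ℝ) ^ (υ + δ) * (1 + Real.log d) * P := by
  obtain ⟨C₁', hC₁'⟩ := hI
  obtain ⟨C₀', hC₀'⟩ := hCd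
  set C₁ := |C₁'|
  set C₀ := |C₀'|
  have hμβ₁ : μ < 1 / (2 * β₁) := hμ0'.trans_le (min_le_left _ _)
  have hμβ₂ : μ < 1 / (2 * β₂) := hμ0'.trans_le (min_le_right _ _)
  set W₁ := C₀ * (3 + β₁) + C₁ * Real.exp 1 * (8 / (μ * δ) ^ 2 + 6)
  set W₂ := (C₀ + C₁ * Real.exp 1) * (3 + 3 / μ) + C₀ / μ
  have hW₁ : 0 ≤ W₁ := by positivity
  have hW₂ : 0 ≤ W₂ := by positivity
  refine ⟨W₁ + W₂ + 1, by positivity, fun d hd P hP => ?_⟩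
  have hd1 : (1 : ℝ) ≤ d := by exact_mod_cast hd
  have hd0 : (0 : ℝ) < d := by linarith
  have hP0 : 0 < P := by linarith
  have hP1 : 1 ≤ P := by linarith
  have hld : 0 ≤ Real.log d := Real.log_nonneg hd1
  have hc : C d ≤ C₀ * (d : ℝ) ^ υ :=
    (hC₀' d hd).trans (by gcongr; exact le_abs_self _)
  have hbox : ∀ K L : ℝ, 1 ≤ K → 1 ≤ L → |boxSum f d K L - C d * K ^ β₁ * L ^ β₂| ≤
      C₁ * (d : ℝ) ^ υ * K ^ β₁ * L ^ β₂ * (min K L) ^ (-δ) := fun K L hK hL =>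
    (hC₁' d hd K L hK hL).trans (by
      have : 0 < min K L := lt_min (by linarith) (by linarith)
      gcongr
      exact le_abs_self _)
  have hAB : (d : ℝ)⁻¹ * P ^ μ ≤ P ^ (1 / (2 * β₁)) := by
    rw [inv_mul_eq_div]
    exact (div_le_self (by positivity) hd1).trans
      (Real.rpow_le_rpow_of_exponent_le hP1 hμβ₁.le)
  have hcurve : (P ^ (1 / (2 * β₁))) ^ β₁ * P ^ (1 / 2 : ℝ) ≤ P := by
    have : 1 / (2 * β₁) * β₁ = 1 / 2 := by field_simp
    rw [← Real.rpow_mul hP0.le, this, ← Real.rpow_add hP0, add_halves, Real.rpow_one]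
  have htsum := tsum_eq_hyperbolaSum_sub f d hβ₁ hβ₂ hP0.le (by positivity) hAB
    (by positivity) hcurve
  rcases le_total (d : ℝ) (P ^ μ) with hdP | hdP
  · rw [htsum]
    refine (abs_hyperbolaSum_truncated_sub_le hf0 hd hβ₁ hβ₂ hδ hμ0 hμβ₁ hμβ₂ (abs_nonneg _)
      (abs_nonneg _) (hC0 d) hc hbox hP1 hdP).trans ?_
    change W₁ * _ * _ * _ ≤ _
    gcongr
    linarith
  · have hupper := hyperbolaSum_le_of_large (A := (d : ℝ)⁻¹ * P ^ μ) hf0 hd hβ₁ hβ₂ hδ hμ0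
      (abs_nonneg _) (abs_nonneg _) (hC0 d) hc hbox hP hdP
    have hdiff := sum_Ioc_eq_boxSum_sub f d ((P ^ (1 / 2 : ℝ)) ^ (1 / β₂)) hAB
    have hdiff0 := hdiff.symm.trans_ge
      (Finset.sum_nonneg fun _ _ => Finset.sum_nonneg fun _ _ => hf0 _ _ _)
    have hT0 : 0 ≤ ∑' kl : ℕ × ℕ,
          if (d : ℝ)⁻¹ * P ^ μ < (kl.1 : ℝ) ∧ (kl.1 : ℝ) ≤ P ^ (1 / (2 * β₁)) ∧
              P ^ (1/2 : ℝ) < (kl.2 : ℝ) ^ β₂ ∧ (kl.2 : ℝ) ^ β₂ ≤ P / (kl.1 : ℝ) ^ β₁ then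
            f d kl.1 kl.2 else 0 :=
      tsum_nonneg fun kl => by split_ifs <;> simp [hf0]
    rw [htsum] at hT0 ⊢
    have hlog : Real.log P ≤ Real.log d / μ := by
      rw [le_div_iff₀ hμ0, mul_comm, ← Real.log_rpow hP0]
      exact Real.log_le_log (by positivity) hdP
    have hlogP : 0 ≤ Real.log P := Real.log_nonneg hP1
    have hhalf : 0 ≤ 1 / 2 - β₁ * μ := by linarith
    have hC : 0 ≤ C d := hC0 d
    have hmain0 : 0 ≤ (1 / 2 - β₁ * μ) * C d * P * Real.log P := by positivity
    have hmain : (1 / 2 - β₁ * μ) * C d * P * Real.log P ≤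
        C₀ / μ * (d : ℝ) ^ (υ + δ) * (1 + Real.log d) * P := by
      calc (1 / 2 - β₁ * μ) * C d * P * Real.log P
          ≤ 1 * (C₀ * (d : ℝ) ^ (υ + δ)) * P * ((1 + Real.log d) / μ) := by
            gcongr
            · linarith
            · exact hc.trans (by gcongr; linarith)
            · exact hlog.trans (by gcongr; linarith)
        _ = _ := by ring
    have hW : (W₁ + W₂ + 1) * (d : ℝ) ^ (υ + δ) * (1 + Real.log d) * P =
        (W₁ + 1) * ((d : ℝ) ^ (υ + δ) * (1 + Real.log d) * P) +
        (C₀ + C₁ * Real.exp 1) * (3 + 3 / μ) * (d : ℝ) ^ (υ + δ) * (1 + Real.log d) * P +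
        C₀ / μ * (d : ℝ) ^ (υ + δ) * (1 + Real.log d) * P := by ring
    have hWX : 0 ≤ (W₁ + 1) * ((d : ℝ) ^ (υ + δ) * (1 + Real.log d) * P) := by positivity
    rw [hW, abs_le]
    constructor
    · have : 0 ≤ (C₀ + C₁ * Real.exp 1) * (3 + 3 / μ) * (d : ℝ) ^ (υ + δ) *
          (1 + Real.log d) * P := by positivity
      linarith
    · have : 0 ≤ C₀ / μ * (d : ℝ) ^ (υ + δ) * (1 + Real.log d) * P := by positivity
      linarith
end
end
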